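/- arXiv:2601.12737 — 2 statements merged into one kernel-verified Lean document; each statement's English description precedes it below -/
import Mathlib

section
/- Let (ν_n)_{n≥1} be a non-decreasing sequence of positive integers and set α = liminf_{n→∞} ν_n/n. If α < ∞, then the Hausdorff dimension of F((ν_n)) equals 1/(2(1+α)). -/
open Filter MeasureTheory Set
open scoped ENNReal NNReal Topology

/-- The Gauss map `T(x) = 1/x - ⌊1/x⌋`. -/
noncomputable def gaussMap (x : ℝ) : ℝ := 1 / x - ⌊1 / x⌋

/-- The `n`-th partial quotient `a_n(x) = ⌊1 / T^{n-1} x⌋` of the regular continued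
fraction expansion of `x` (meaningful for `n ≥ 1` and `x` irrational in `(0,1)`). -/
noncomputable def pq (x : ℝ) (n : ℕ) : ℕ := (⌊1 / (gaussMap^[n - 1] x)⌋).toNat

/-- The set `J` of irrationals in `(0,1)` with strictly increasing partial quotients. -/
def Jset : Set ℝ :=
  {x | x ∈ Set.Ioo (0 : ℝ) 1 ∧ Irrational x ∧ ∀ n : ℕ, 1 ≤ n → pq x n < pq x (n + 1)}

/-- The finite sequence `b start, b (start+1), …, b (start+len-1)` is an
arithmetic progression. -/
def IsAPAt (b : ℕ → ℕ) (start len : ℕ) : Prop :=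
  ∃ d : ℤ, ∀ i : ℕ, i + 2 ≤ len → (b (start + i + 1) : ℤ) - (b (start + i) : ℤ) = d

/-- The `F`-set: points of `J` such that for infinitely many `n ≥ 1` the partial
quotients `a_n(x), …, a_{n+ν_n-1}(x)` form an arithmetic progression. -/
def Fset (ν : ℕ → ℕ) : Set ℝ :=
  {x | x ∈ Jset ∧ ∀ N : ℕ, ∃ n : ℕ, N ≤ n ∧ 1 ≤ n ∧ IsAPAt (pq x) n (ν n)}

/-- The `G`-set: points of `J` such that for all sufficiently large `n` the partial
quotients `a_{σ_n}(x), …, a_{σ_n+n-1}(x)` form an arithmetic progression. -/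
def Gset (σ : ℕ → ℕ) : Set ℝ :=
  {x | x ∈ Jset ∧ ∃ N : ℕ, ∀ n : ℕ, N ≤ n → IsAPAt (pq x) (σ n) n}

/-- `y` is the sequence of complete tails of the continued fraction with partial quotients `b`:
`y n = 1 / (b n + y (n + 1))`, all tails lying strictly between `0` and `1`. -/
structure IsTails (b : ℕ → ℕ) (y : ℕ → ℝ) : Prop where
  pos : ∀ n, 0 < y n
  lt_one : ∀ n, y n < 1
  mul_eq : ∀ n, y n * (b n + y (n + 1)) = 1

namespace IsTails

variable {b b' : ℕ → ℕ} {y y' : ℕ → ℝ}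

theorem inv_eq (h : IsTails b y) (n : ℕ) : 1 / y n = b n + y (n + 1) := by
  rw [div_eq_iff (h.pos n).ne', mul_comm, h.mul_eq n]

theorem floor_inv (h : IsTails b y) (n : ℕ) : ⌊1 / y n⌋ = (b n : ℤ) := by
  rw [h.inv_eq, Int.floor_eq_iff]
  have h1 := h.pos (n + 1)
  have h2 := h.lt_one (n + 1)
  push_cast
  constructor <;> linarith

theorem gaussMap_eq (h : IsTails b y) (n : ℕ) : gaussMap (y n) = y (n + 1) := by
  rw [gaussMap, h.floor_inv, h.inv_eq]
  push_cast
  ring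

theorem iterate_gaussMap (h : IsTails b y) (n : ℕ) : gaussMap^[n] (y 0) = y n := by
  induction n with
  | zero => rfl
  | succ n ih => rw [Function.iterate_succ_apply', ih, h.gaussMap_eq]

theorem pq_eq (h : IsTails b y) (n : ℕ) : pq (y 0) (n + 1) = b n := by
  rw [pq, Nat.add_sub_cancel, h.iterate_gaussMap, h.floor_inv, Int.toNat_natCast]

theorem ne_natCast_div (h : IsTails b y) (p : ℕ) : ∀ n q : ℕ, y n ≠ p / q := by
  induction p using Nat.strong_induction_on with
  | _ p ih =>
    intro n q hpq
    have h0 := h.pos n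
    have hp : 0 < p := by
      rcases Nat.eq_zero_or_pos p with rfl | hp
      · simp [hpq] at h0
      · exact hp
    have hp' : (0 : ℝ) < p := by exact_mod_cast hp
    have hy : y (n + 1) = (q - b n * p) / p := by
      have := h.inv_eq n
      rw [hpq, one_div_div] at this
      field_simp
      field_simp at this
      linarith
    have h1 := h.pos (n + 1)
    have h2 := h.lt_one (n + 1)
    rw [hy, div_lt_one hp'] at h2
    rw [hy] at h1
    have h3 : (0 : ℝ) < q - b n * p := by
      rcases div_pos_iff.1 h1 with h | h
      · exact h.1
      · linarith [h.2]
    have hle : b n * p ≤ q := by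
      have : ((b n * p : ℕ) : ℝ) ≤ q := by push_cast; linarith
      exact_mod_cast this
    refine ih (q - b n * p) ?_ (n + 1) p ?_
    · have : ((q - b n * p : ℕ) : ℝ) < p := by push_cast [hle]; exact h2
      exact_mod_cast this
    · rw [hy]; push_cast [hle]; rfl

theorem irrational (h : IsTails b y) : Irrational (y 0) := by
  rintro ⟨r, hr⟩
  have h0 : 0 < r := by
    have := h.pos 0
    rw [← hr] at this
    exact_mod_cast this
  refine h.ne_natCast_div r.num.toNat 0 r.den ?_
  have hn : ((r.num.toNat : ℤ) : ℝ) = r.num := by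
    rw [Int.toNat_of_nonneg (Rat.num_pos.2 h0).le]
  rw [← hr, ← Int.cast_natCast (R := ℝ) r.num.toNat, hn]
  exact_mod_cast (Rat.num_div_den r).symm

theorem le_one_div (h : IsTails b y) (n : ℕ) (hb : 0 < b n) : y n ≤ 1 / b n := by
  have hb' : (0 : ℝ) < b n := by exact_mod_cast hb
  rw [le_div_iff₀ hb', ← h.mul_eq n]
  have := mul_pos (h.pos n) (h.pos (n + 1))
  linarith

theorem one_div_le (h : IsTails b y) (n : ℕ) : 1 / (b n + 1 : ℝ) ≤ y n := by
  rw [div_le_iff₀ (by positivity)]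
  exact (h.mul_eq n).ge.trans
    (mul_le_mul_of_nonneg_left (by linarith [h.lt_one (n + 1)]) (h.pos n).le)

theorem sub_eq (h : IsTails b y) (h' : IsTails b' y') (n : ℕ) :
    y' n - y n = y n * y' n * (b n - b' n + (y (n + 1) - y' (n + 1))) := by
  linear_combination y n * h'.mul_eq n - y' n * h.mul_eq n

theorem abs_sub_eq (h : IsTails b y) (h' : IsTails b' y') (i : ℕ) (hb : ∀ j < i, b j = b' j) :
    |y 0 - y' 0| = (∏ j ∈ Finset.range i, y j * y' j) * |y i - y' i| := by
  induction i with
  | zero => simp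
  | succ i ih =>
    rw [ih fun j hj => hb j (by omega), Finset.prod_range_succ, mul_assoc]
    congr 1
    rw [abs_sub_comm, h.sub_eq h', hb i (by omega), sub_self, zero_add, abs_mul,
      abs_of_pos (mul_pos (h.pos i) (h'.pos i))]

theorem abs_sub_le (h : IsTails b y) (h' : IsTails b' y') (i : ℕ) (hb : ∀ j < i, b j = b' j)
    (hpos : ∀ j < i, 0 < b j) :
    |y 0 - y' 0| ≤ ∏ j ∈ Finset.range i, (1 / b j : ℝ) ^ 2 := by
  rw [h.abs_sub_eq h' i hb, ← mul_one (∏ j ∈ Finset.range i, (1 / b j : ℝ) ^ 2)]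
  have h1 := h.pos i
  have h2 := h.lt_one i
  have h3 := h'.pos i
  have h4 := h'.lt_one i
  refine mul_le_mul (Finset.prod_le_prod (fun j _ => (mul_pos (h.pos j) (h'.pos j)).le)
    fun j hj => ?_) (abs_le.2 ⟨by linarith, by linarith⟩) (abs_nonneg _) (by positivity)
  have hj' := Finset.mem_range.1 hj
  rw [sq]
  exact mul_le_mul (h.le_one_div j (hpos j hj'))
    (by rw [hb j hj']; exact h'.le_one_div j (hb j hj' ▸ hpos j hj')) (h'.pos j).le (by positivity)

theorem le_abs_sub (h : IsTails b y) (h' : IsTails b' y') (i : ℕ) (hb : ∀ j < i, b j = b' j)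
    (hne : b i ≠ b' i) (h2 : 2 ≤ b (i + 1)) (h2' : 2 ≤ b' (i + 1)) (B : ℝ) (hB : 0 < B)
    (hbB : ∀ j ≤ i, (b j + 1 : ℝ) ≤ B) (hbB' : ∀ j ≤ i, (b' j + 1 : ℝ) ≤ B) :
    1 / 2 * (1 / B) ^ (2 * (i + 1)) ≤ |y 0 - y' 0| := by
  have key : ∀ j ≤ i, (1 / B) ^ 2 ≤ y j * y' j := fun j hj => by
    rw [sq]
    exact mul_le_mul
      ((one_div_le_one_div_of_le (by positivity) (hbB j hj)).trans (h.one_div_le j))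
      ((one_div_le_one_div_of_le (by positivity) (hbB' j hj)).trans (h'.one_div_le j))
      (by positivity) (h.pos j).le
  have half : ∀ {b : ℕ → ℕ} {y : ℕ → ℝ}, IsTails b y → 2 ≤ b (i + 1) → y (i + 1) ≤ 1 / 2 :=
    fun h h2 => (h.le_one_div _ (by omega)).trans
      (one_div_le_one_div_of_le (by norm_num) (by exact_mod_cast h2))
  have hlast : 1 / 2 ≤ |(b i - b' i + (y (i + 1) - y' (i + 1)) : ℝ)| := by
    have := h.pos (i + 1)
    have := h'.pos (i + 1)
    have := half h h2
    have := half h' h2'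
    rcases lt_or_gt_of_ne hne with hlt | hlt
    · have : (b i + 1 : ℝ) ≤ b' i := by exact_mod_cast hlt
      exact le_abs.2 (Or.inr (by linarith))
    · have : (b' i + 1 : ℝ) ≤ b i := by exact_mod_cast hlt
      exact le_abs.2 (Or.inl (by linarith))
  rw [h.abs_sub_eq h' i hb, abs_sub_comm (y i), h.sub_eq h', abs_mul,
    abs_of_pos (mul_pos (h.pos i) (h'.pos i)), ← mul_assoc, ← Finset.prod_range_succ, mul_comm]
  refine mul_le_mul ?_ hlast (by norm_num)
    (Finset.prod_nonneg fun j _ => (mul_pos (h.pos j) (h'.pos j)).le)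
  calc (1 / B) ^ (2 * (i + 1)) = ∏ j ∈ Finset.range (i + 1), (1 / B) ^ 2 := by
        rw [Finset.prod_const, Finset.card_range, pow_mul]
    _ ≤ _ := Finset.prod_le_prod (fun j _ => by positivity)
        fun j hj => key j (by simpa [Nat.lt_succ_iff] using hj)

end IsTails

theorem exists_isTails (b : ℕ → ℕ) (hb : ∀ n, 0 < b n) : ∃ y, IsTails b y := by
  let t : ℕ → Set (ℕ → ℝ) := fun N =>
    {y | (∀ n, y n ∈ Icc (0 : ℝ) 1) ∧ ∀ n < N, y n * (b n + y (n + 1)) = 1}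
  have hclosed : ∀ N, IsClosed (t N) := fun N => by
    simp only [t, ofPred_and, ofPred_forall]
    refine IsClosed.inter (isClosed_iInter fun n => ?_)
      (isClosed_iInter fun n => isClosed_iInter fun _ => ?_)
    · exact isClosed_Icc.preimage (continuous_apply n)
    · exact isClosed_eq (by fun_prop) continuous_const
  have hcompact : IsCompact (t 0) :=
    (isCompact_univ_pi fun _ : ℕ => isCompact_Icc (a := (0 : ℝ)) (b := 1)).of_isClosed_subset
      (hclosed 0) fun y hy n _ => hy.1 n
  have hne : ∀ N (b : ℕ → ℕ), (∀ n, 0 < b n) → ∃ y : ℕ → ℝ, (∀ n, y n ∈ Icc (0 : ℝ) 1) ∧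
      ∀ n < N, y n * (b n + y (n + 1)) = 1 := by
    intro N
    induction N with
    | zero => exact fun _ _ => ⟨0, by simp, by simp⟩
    | succ N ih =>
      intro b hb
      obtain ⟨y, hy, hy'⟩ := ih (fun n => b (n + 1)) fun n => hb (n + 1)
      have hb0 : (1 : ℝ) ≤ b 0 := by exact_mod_cast hb 0
      have hpos : (1 : ℝ) ≤ b 0 + y 0 := by linarith [(hy 0).1]
      refine ⟨fun n => n.casesOn (1 / (b 0 + y 0)) y, ?_, ?_⟩
      · rintro (_ | n)
        · exact ⟨one_div_nonneg.2 (by linarith), (div_le_one (by linarith)).2 hpos⟩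
        · exact hy n
      · rintro (_ | n) hn
        · exact one_div_mul_cancel (by linarith)
        · exact hy' n (by omega)
  obtain ⟨y, hy⟩ := IsCompact.nonempty_iInter_of_sequence_nonempty_isCompact_isClosed t
    (fun i y hy => ⟨hy.1, fun n hn => hy.2 n (by omega)⟩) (fun N => hne N b hb) hcompact hclosed
  rw [mem_iInter] at hy
  have heq : ∀ n, y n * (b n + y (n + 1)) = 1 := fun n => (hy (n + 1)).2 n (by omega)
  have hpos : ∀ n, 0 < y n := fun n => by
    refine lt_of_le_of_ne ((hy 0).1 n).1 fun h => ?_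
    have := heq n
    simp [← h] at this
  refine ⟨y, hpos, fun n => ?_, heq⟩
  have hbn : (1 : ℝ) ≤ b n := by exact_mod_cast hb n
  rw [← heq n]
  exact lt_mul_of_one_lt_right (hpos n) (by linarith [hpos (n + 1)])

theorem isTails_of_irrational {x : ℝ} (hx : x ∈ Ioo (0 : ℝ) 1) (hirr : Irrational x) :
    IsTails (fun n => pq x (n + 1)) fun n => gaussMap^[n] x := by
  have key : ∀ n, Irrational (gaussMap^[n] x) ∧ gaussMap^[n] x ∈ Ioo (0 : ℝ) 1 := by
    intro n
    induction n with
    | zero => exact ⟨hirr, hx⟩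
    | succ n ih =>
      rw [Function.iterate_succ_apply']
      have h : Irrational (gaussMap (gaussMap^[n] x)) := by
        rw [gaussMap, one_div]
        exact (irrational_inv_iff.2 ih.1).sub_intCast _
      exact ⟨h, lt_of_le_of_ne (Int.fract_nonneg _) h.ne_zero.symm, Int.fract_lt_one _⟩
  refine ⟨fun n => (key n).2.1, fun n => (key n).2.2, fun n => ?_⟩
  obtain ⟨h0, h1⟩ := (key n).2
  have hfloor : 0 ≤ ⌊1 / gaussMap^[n] x⌋ := Int.floor_nonneg.2 (by positivity)
  have hc : ((pq x (n + 1) : ℕ) : ℝ) = ⌊1 / gaussMap^[n] x⌋ := by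
    rw [pq, Nat.add_sub_cancel, ← Int.cast_natCast, Int.toNat_of_nonneg hfloor]
  simp only [hc]
  rw [Function.iterate_succ_apply']
  conv_lhs => enter [2, 2]; rw [gaussMap]
  field_simp
  ring

theorem IsAPAt.eq_of_eq {b b' : ℕ → ℕ} {n m : ℕ} (h : IsAPAt b n m) (h' : IsAPAt b' n m)
    (h0 : b n = b' n) (h1 : b (n + 1) = b' (n + 1)) : ∀ i < m, b (n + i) = b' (n + i) := by
  obtain ⟨d, hd⟩ := h
  obtain ⟨d', hd'⟩ := h'
  intro i
  induction i with
  | zero => exact fun _ => h0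
  | succ i ih =>
    intro hi
    have e := hd 0 (by omega)
    have e' := hd' 0 (by omega)
    have ei := hd i (by omega)
    have ei' := hd' i (by omega)
    have := ih (by omega)
    simp only [add_zero] at e e'
    rw [← add_assoc]
    omega

theorem ENNReal.tsum_fin_prod (g : ℕ → ℝ≥0∞) (n : ℕ) :
    ∑' f : Fin n → ℕ, ∏ i, g (f i) = (∑' a, g a) ^ n := by
  induction n with
  | zero => simp
  | succ n ih =>
    rw [← (Fin.consEquiv fun _ => ℕ).tsum_eq, ENNReal.tsum_prod']
    simp [Fin.prod_univ_succ, ENNReal.tsum_mul_left, ih, ENNReal.tsum_mul_right, pow_succ']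

theorem Jset.isTails {x : ℝ} (hx : x ∈ Jset) :
    IsTails (fun n => pq x (n + 1)) fun n => gaussMap^[n] x :=
  isTails_of_irrational hx.1 hx.2.1

theorem Jset.strictMono {x : ℝ} (hx : x ∈ Jset) : StrictMono fun n => pq x (n + 1) :=
  strictMono_nat_of_lt_succ fun n => hx.2.2 (n + 1) (by omega)

theorem Jset.pq_one_pos {x : ℝ} (hx : x ∈ Jset) : 0 < pq x 1 := by
  have h := (Jset.isTails hx).mul_eq 0
  have h0 := (Jset.isTails hx).lt_one 0
  have h1 := (Jset.isTails hx).lt_one 1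
  have h2 := (Jset.isTails hx).pos 0
  have h3 := (Jset.isTails hx).pos 1
  by_contra hc
  simp only [zero_add, show pq x 1 = 0 by omega, Nat.cast_zero] at h
  nlinarith

theorem Jset.succ_le_pq {x : ℝ} (hx : x ∈ Jset) (n : ℕ) : n + 1 ≤ pq x (n + 1) := by
  induction n with
  | zero => exact Jset.pq_one_pos hx
  | succ n ih => have := hx.2.2 (n + 1) (by omega); omega

/-- The points of `Jset` whose first `n + 1` partial quotients are given by `f` and whose
partial quotients form an arithmetic progression of length `m` from index `n` on. -/
def apCylinder (n m : ℕ) (f : Fin (n + 1) → ℕ) : Set ℝ :=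
  {x | x ∈ Jset ∧ IsAPAt (pq x) n m ∧ ∀ i : Fin (n + 1), pq x (i + 1) = f i}

theorem factorial_le_of_mem_apCylinder {n m : ℕ} {f : Fin (n + 1) → ℕ} {x : ℝ}
    (hx : x ∈ apCylinder n m f) : (n + 1).factorial ≤ ∏ i, f i := by
  rw [← Finset.prod_range_add_one_eq_factorial, ← Fin.prod_univ_eq_prod_range (fun i => i + 1)]
  exact Finset.prod_le_prod' fun i _ => hx.2.2 i ▸ Jset.succ_le_pq hx.1 i

theorem abs_sub_le_of_mem_apCylinder {n m : ℕ} (hn : 1 ≤ n) {f : Fin (n + 1) → ℕ} {x x' : ℝ}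
    (hx : x ∈ apCylinder n m f) (hx' : x' ∈ apCylinder n m f) :
    |x - x'| ≤ ((∏ i, f i : ℕ) : ℝ) ^ (-(2 * (1 + ((m - 2 : ℕ) : ℝ) / (n + 1)))) := by
  set k := m - 2
  set b : ℕ → ℕ := fun j => pq x (j + 1) with hbdef
  have hpos : ∀ j, 0 < b j := fun j => (Nat.succ_pos j).trans_le (Jset.succ_le_pq hx.1 j)
  have hmono : StrictMono b := Jset.strictMono hx.1
  have heq : ∀ j < n + 1, b j = pq x' (j + 1) := fun j hj =>
    (hx.2.2 ⟨j, hj⟩).trans (hx'.2.2 ⟨j, hj⟩).symm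
  have heq' : ∀ j < n + 1 + k, b j = pq x' (j + 1) := by
    intro j hj
    rcases lt_or_ge j (n + 1) with hj' | hj'
    · exact heq j hj'
    · have e0 := heq (n - 1) (by omega)
      simp only [hbdef, Nat.sub_add_cancel hn] at e0
      have := hx.2.1.eq_of_eq hx'.2.1 e0 (heq n (by omega)) (j + 1 - n) (by omega)
      rwa [Nat.add_sub_cancel' (by omega)] at this
  have hQ : (∏ i, f i) = ∏ j ∈ Finset.range (n + 1), b j := by
    rw [← Fin.prod_univ_eq_prod_range]
    exact Finset.prod_congr rfl fun i _ => (hx.2.2 i).symm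
  set Q := ∏ i, f i
  have hQpos : (0 : ℝ) < Q := by
    rw [hQ]; exact_mod_cast Finset.prod_pos fun j _ => hpos j
  have hroot : (Q : ℝ) ^ (1 / (n + 1 : ℝ)) ≤ b n := by
    have hle : (Q : ℝ) ≤ (b n : ℝ) ^ (n + 1) := by
      have : Q ≤ b n ^ (n + 1) := by
        rw [hQ]
        calc ∏ j ∈ Finset.range (n + 1), b j ≤ ∏ j ∈ Finset.range (n + 1), b n :=
              Finset.prod_le_prod' fun j hj =>
                hmono.monotone (Nat.lt_succ_iff.1 (Finset.mem_range.1 hj))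
          _ = b n ^ (n + 1) := by simp
      exact_mod_cast this
    calc (Q : ℝ) ^ (1 / (n + 1 : ℝ)) ≤ ((b n : ℝ) ^ (n + 1)) ^ (1 / (n + 1 : ℝ)) := by gcongr
      _ = b n := by
        have := Real.pow_rpow_inv_natCast (x := (b n : ℝ)) (by positivity) (Nat.succ_ne_zero n)
        simpa using this
  have h1 := (Jset.isTails hx.1).abs_sub_le (Jset.isTails hx'.1) (n + 1 + k) heq'
    fun j _ => hpos j
  refine h1.trans ?_
  have hprod : (Q : ℝ) * ((Q : ℝ) ^ (1 / (n + 1 : ℝ))) ^ k ≤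
      ∏ j ∈ Finset.range (n + 1 + k), (b j : ℝ) := by
    have hQc : ∏ j ∈ Finset.range (n + 1), (b j : ℝ) = Q := by rw [hQ, Nat.cast_prod]
    rw [Finset.prod_range_add, hQc]
    refine mul_le_mul_of_nonneg_left ?_ (by positivity)
    calc ((Q : ℝ) ^ (1 / (n + 1 : ℝ))) ^ k = ∏ j ∈ Finset.range k, (Q : ℝ) ^ (1 / (n + 1 : ℝ)) := by
          simp
      _ ≤ _ := Finset.prod_le_prod (fun _ _ => by positivity) fun j _ => hroot.trans (by
          exact_mod_cast hmono.monotone (by omega))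
  have hpow : (Q : ℝ) * ((Q : ℝ) ^ (1 / (n + 1 : ℝ))) ^ k = (Q : ℝ) ^ (1 + (k : ℝ) / (n + 1)) := by
    rw [Real.rpow_add hQpos, Real.rpow_one, ← Real.rpow_natCast, ← Real.rpow_mul hQpos.le]
    congr 2
    ring
  rw [hpow] at hprod
  rw [Finset.prod_pow, Finset.prod_div_distrib, Finset.prod_const_one, Real.rpow_neg hQpos.le,
    mul_comm (2 : ℝ), Real.rpow_mul hQpos.le, Real.rpow_two, div_pow, one_pow, ← one_div]
  exact one_div_le_one_div_of_le (by positivity) (by gcongr)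

theorem ediam_apCylinder_le {n m : ℕ} (hn : 1 ≤ n) (f : Fin (n + 1) → ℕ) :
    Metric.ediam (apCylinder n m f) ≤
      ENNReal.ofReal (((∏ i, f i : ℕ) : ℝ) ^ (-(2 * (1 + ((m - 2 : ℕ) : ℝ) / (n + 1))))) :=
  Metric.ediam_le fun x hx x' hx' => by
    rw [edist_dist, Real.dist_eq]
    exact ENNReal.ofReal_le_ofReal (abs_sub_le_of_mem_apCylinder hn hx hx')

theorem ediam_apCylinder_le_inv {n m : ℕ} (hn : 1 ≤ n) (f : Fin (n + 1) → ℕ) :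
    Metric.ediam (apCylinder n m f) ≤ ENNReal.ofReal (1 / (n + 1)) := by
  rcases (apCylinder n m f).eq_empty_or_nonempty with h | ⟨x, hx⟩
  · simp [h]
  refine (ediam_apCylinder_le hn f).trans (ENNReal.ofReal_le_ofReal ?_)
  have hQ : n + 1 ≤ ∏ i, f i :=
    (Nat.self_le_factorial _).trans (factorial_le_of_mem_apCylinder hx)
  have hQ' : (n + 1 : ℝ) ≤ (∏ i, f i : ℕ) := by exact_mod_cast hQ
  have h1 : (1 : ℝ) ≤ (∏ i, f i : ℕ) := by linarith [(Nat.cast_nonneg n : (0 : ℝ) ≤ n)]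
  calc _ ≤ ((∏ i, f i : ℕ) : ℝ) ^ (-1 : ℝ) := by
        refine Real.rpow_le_rpow_of_exponent_le h1 ?_
        have : (0 : ℝ) ≤ ((m - 2 : ℕ) : ℝ) / (n + 1) := by positivity
        linarith
    _ ≤ _ := by
        rw [Real.rpow_neg_one, ← one_div]
        exact one_div_le_one_div_of_le (by positivity) hQ'

theorem ediam_apCylinder_rpow_le {n m : ℕ} (hn : 1 ≤ n) (f : Fin (n + 1) → ℕ) {s ε : ℝ}
    (hs : 0 < s) (hε : 0 < ε)
    (hse : 1 + 2 * ε ≤ 2 * s * (1 + ((m - 2 : ℕ) : ℝ) / (n + 1))) :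
    Metric.ediam (apCylinder n m f) ^ s ≤
      ENNReal.ofReal (((n + 1).factorial : ℝ) ^ (-ε)) *
        ∏ i, ENNReal.ofReal ((f i : ℝ) ^ (-(1 + ε))) := by
  rcases (apCylinder n m f).eq_empty_or_nonempty with h | ⟨x, hx⟩
  · simp [h, hs]
  have hQ := factorial_le_of_mem_apCylinder hx
  have hN : 0 < (n + 1).factorial := Nat.factorial_pos _
  have hN' : (0 : ℝ) < (n + 1).factorial := by exact_mod_cast hN
  have hQ' : ((n + 1).factorial : ℝ) ≤ (∏ i, f i : ℕ) := by exact_mod_cast hQ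
  have h1 : (1 : ℝ) ≤ (∏ i, f i : ℕ) := by exact_mod_cast (hN.trans_le hQ)
  have h0 : (0 : ℝ) < (∏ i, f i : ℕ) := by linarith
  calc Metric.ediam (apCylinder n m f) ^ s ≤ (ENNReal.ofReal (((∏ i, f i : ℕ) : ℝ) ^
          (-(2 * (1 + ((m - 2 : ℕ) : ℝ) / (n + 1)))))) ^ s := by
        gcongr; exact ediam_apCylinder_le hn f
    _ = ENNReal.ofReal (((∏ i, f i : ℕ) : ℝ) ^
          (-(2 * s * (1 + ((m - 2 : ℕ) : ℝ) / (n + 1))))) := by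
        rw [ENNReal.ofReal_rpow_of_nonneg (by positivity) hs.le, ← Real.rpow_mul h0.le]
        congr 2
        ring
    _ ≤ ENNReal.ofReal (((n + 1).factorial : ℝ) ^ (-ε) *
          ((∏ i, f i : ℕ) : ℝ) ^ (-(1 + ε))) := by
        refine ENNReal.ofReal_le_ofReal ?_
        calc _ ≤ ((∏ i, f i : ℕ) : ℝ) ^ (-ε + -(1 + ε)) :=
              Real.rpow_le_rpow_of_exponent_le h1 (by linarith)
          _ = ((∏ i, f i : ℕ) : ℝ) ^ (-ε) * ((∏ i, f i : ℕ) : ℝ) ^ (-(1 + ε)) :=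
              Real.rpow_add h0 _ _
          _ ≤ _ := mul_le_mul_of_nonneg_right
              (Real.rpow_le_rpow_of_nonpos hN' hQ' (by linarith)) (by positivity)
    _ = _ := by
        rw [ENNReal.ofReal_mul (by positivity), Nat.cast_prod,
          ← Real.finsetProd_rpow _ _ (fun i _ => by positivity),
          ENNReal.ofReal_prod_of_nonneg (fun i _ => by positivity)]

theorem pow_mul_factorial_rpow_neg_le {z ε : ℝ} (hz : 0 ≤ z) (hε : 0 < ε) (n : ℕ) :
    (n.factorial : ℝ) ^ (-ε) * z ^ n ≤
      Real.exp ((2 * z) ^ (1 / ε)) ^ ε * (1 / 2) ^ n := by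
  set w := (2 * z) ^ (1 / ε) with hw
  have hw0 : 0 ≤ w := by positivity
  have hwε : w ^ ε = 2 * z := by
    rw [hw, ← Real.rpow_mul (by positivity), one_div_mul_cancel hε.ne', Real.rpow_one]
  have h := Real.pow_div_factorial_le_exp w hw0 n
  have h2 : (w ^ n / n.factorial) ^ ε ≤ Real.exp w ^ ε := by gcongr
  refine le_trans (le_of_eq ?_) (mul_le_mul_of_nonneg_right h2 (by positivity))
  rw [Real.div_rpow (by positivity) (by positivity), ← Real.rpow_natCast w, ← Real.rpow_mul hw0,
    mul_comm (n : ℝ) ε, Real.rpow_mul hw0, hwε, Real.rpow_natCast, Real.rpow_neg (by positivity),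
    mul_pow, one_div, inv_pow]
  field_simp

theorem dimH_Fset_le_of_eventually (ν : ℕ → ℕ) {s : ℝ≥0} {ε : ℝ} (hs : 0 < s) (hε : 0 < ε)
    (h : ∀ᶠ n : ℕ in atTop, 1 + 2 * ε ≤ 2 * (s : ℝ) * (1 + ((ν n - 2 : ℕ) : ℝ) / (n + 1))) :
    dimH (Fset ν) ≤ s := by
  apply dimH_le_of_hausdorffMeasure_ne_top
  set g : ℕ → ℝ := fun a => (a : ℝ) ^ (-(1 + ε))
  have hg0 : ∀ a, 0 ≤ g a := fun a => by positivity
  have hgs : Summable g := Real.summable_nat_rpow.2 (by linarith)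
  set z := ∑' a, g a
  have hz0 : 0 ≤ z := tsum_nonneg hg0
  set A := Real.exp ((2 * z) ^ (1 / ε)) ^ ε
  have hA0 : 0 ≤ A := by positivity
  have hsum : Summable fun k : ℕ => A * (1 / 2 : ℝ) ^ k :=
    (summable_geometric_of_lt_one (by norm_num) (by norm_num)).mul_left A
  obtain ⟨N, hN⟩ := eventually_atTop.1 h
  let t : ∀ K : ℕ, (Σ k : ℕ, (Fin (K + k + 1) → ℕ)) → Set ℝ := fun K p =>
    apCylinder (K + p.1) (ν (K + p.1)) p.2
  have hle : ∀ K, max N 1 ≤ K →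
      ∑' p, Metric.ediam (t K p) ^ (s : ℝ) ≤ ENNReal.ofReal (∑' k : ℕ, A * (1 / 2 : ℝ) ^ k) := by
    intro K hK
    rw [ENNReal.tsum_sigma', ENNReal.ofReal_tsum_of_nonneg (fun _ => by positivity) hsum]
    refine ENNReal.tsum_le_tsum fun k => ?_
    have hn : 1 ≤ K + k := by omega
    calc ∑' f : Fin (K + k + 1) → ℕ, Metric.ediam (t K ⟨k, f⟩) ^ (s : ℝ)
        ≤ ∑' f : Fin (K + k + 1) → ℕ, ENNReal.ofReal (((K + k + 1).factorial : ℝ) ^ (-ε)) *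
          ∏ i, ENNReal.ofReal (g (f i)) :=
          ENNReal.tsum_le_tsum fun f => ediam_apCylinder_rpow_le hn f (by exact_mod_cast hs) hε
            (hN _ (by omega))
      _ = ENNReal.ofReal (((K + k + 1).factorial : ℝ) ^ (-ε) * z ^ (K + k + 1)) := by
          rw [ENNReal.tsum_mul_left, ENNReal.tsum_fin_prod (fun a => ENNReal.ofReal (g a)),
            ← ENNReal.ofReal_tsum_of_nonneg hg0 hgs, ← ENNReal.ofReal_pow hz0,
            ← ENNReal.ofReal_mul (by positivity)]
      _ ≤ _ := by
          refine ENNReal.ofReal_le_ofReal ((pow_mul_factorial_rpow_neg_le hz0 hε _).trans ?_)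
          exact mul_le_mul_of_nonneg_left
            (pow_le_pow_of_le_one (by norm_num) (by norm_num) (by omega)) hA0
  have hlim : Tendsto (fun K : ℕ => ENNReal.ofReal (1 / ((K : ℝ) + 1))) atTop (𝓝 0) := by
    rw [← ENNReal.ofReal_zero]
    exact ENNReal.tendsto_ofReal tendsto_one_div_add_atTop_nhds_zero_nat
  have hH := Measure.hausdorffMeasure_le_liminf_tsum (s : ℝ) (Fset ν) _ hlim t
    (by
      filter_upwards [eventually_ge_atTop 1] with K hK p
      refine (ediam_apCylinder_le_inv (by omega) _).trans (ENNReal.ofReal_le_ofReal ?_)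
      exact one_div_le_one_div_of_le (by positivity) (by push_cast; simp))
    (Eventually.of_forall fun K x hx => by
      obtain ⟨n, hKn, -, hap⟩ := hx.2 K
      obtain ⟨k, rfl⟩ := Nat.exists_eq_add_of_le hKn
      exact mem_iUnion.2 ⟨⟨k, fun i => pq x (i + 1)⟩, hx.1, hap, fun _ => rfl⟩)
  refine (hH.trans_lt (lt_of_le_of_lt (liminf_le_of_frequently_le' (Eventually.frequently ?_))
    (ENNReal.ofReal_lt_top (r := ∑' k : ℕ, A * (1 / 2 : ℝ) ^ k)))).ne
  filter_upwards [eventually_ge_atTop (max N 1)] with K hK using hle K hK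

theorem eventually_mul_le_of_lt_liminf {ν : ℕ → ℕ} {a : ℝ≥0}
    (ha : (a : ℝ≥0∞) = liminf (fun n : ℕ => (ν n : ℝ≥0∞) / (n : ℝ≥0∞)) atTop) {r : ℝ}
    (hr : r < a) : ∀ᶠ n : ℕ in atTop, r * n ≤ ν n := by
  rcases lt_or_ge r 0 with h0 | h0
  · exact Eventually.of_forall fun n =>
      (mul_nonpos_of_nonpos_of_nonneg h0.le n.cast_nonneg).trans (ν n).cast_nonneg
  lift r to ℝ≥0 using h0
  have hlt : (r : ℝ≥0∞) < liminf (fun n : ℕ => (ν n : ℝ≥0∞) / (n : ℝ≥0∞)) atTop := by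
    rw [← ha]; exact_mod_cast hr
  filter_upwards [eventually_lt_of_lt_liminf hlt, eventually_gt_atTop 0] with n hn hn0
  have hle := (ENNReal.le_div_iff_mul_le (Or.inl (by exact_mod_cast hn0.ne'))
    (Or.inl (ENNReal.natCast_ne_top n))).1 hn.le
  have : r * (n : ℝ≥0) ≤ ν n := by exact_mod_cast hle
  exact_mod_cast this

theorem frequently_le_mul_of_liminf_lt {ν : ℕ → ℕ} {a : ℝ≥0}
    (ha : (a : ℝ≥0∞) = liminf (fun n : ℕ => (ν n : ℝ≥0∞) / (n : ℝ≥0∞)) atTop) {r : ℝ}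
    (hr : a < r) : ∃ᶠ n : ℕ in atTop, (ν n : ℝ) ≤ r * n := by
  lift r to ℝ≥0 using a.2.trans hr.le
  have hlt : liminf (fun n : ℕ => (ν n : ℝ≥0∞) / (n : ℝ≥0∞)) atTop < (r : ℝ≥0∞) := by
    rw [← ha]; exact_mod_cast hr
  refine ((frequently_lt_of_liminf_lt (h := hlt)).and_eventually (eventually_gt_atTop 0)).mono ?_
  rintro n ⟨hn, hn0⟩
  have hle := (ENNReal.div_le_iff_le_mul (Or.inl (by exact_mod_cast hn0.ne'))
    (Or.inl (ENNReal.natCast_ne_top n))).1 hn.le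
  have : (ν n : ℝ≥0) ≤ r * n := by exact_mod_cast hle
  exact_mod_cast this

theorem dimH_Fset_le {ν : ℕ → ℕ} {a : ℝ≥0}
    (ha : (a : ℝ≥0∞) = liminf (fun n : ℕ => (ν n : ℝ≥0∞) / (n : ℝ≥0∞)) atTop) :
    dimH (Fset ν) ≤ ((1 / (2 * (1 + a)) : ℝ≥0) : ℝ≥0∞) := by
  refine le_of_forall_gt_imp_ge_of_dense fun e he => ?_
  obtain ⟨s, hs, hse⟩ := ENNReal.lt_iff_exists_nnreal_btwn.1 he
  refine le_trans ?_ hse.le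
  have hs' : 1 / (2 * (1 + a)) < s := by exact_mod_cast hs
  have hs0 : 0 < s := lt_of_le_of_lt zero_le hs'
  have hsr : (1 : ℝ) < s * (2 * (1 + a)) := by
    have : 1 < s * (2 * (1 + a)) := by rwa [div_lt_iff₀ (by positivity)] at hs'
    exact_mod_cast this
  have hs0r : (0 : ℝ) < s := by exact_mod_cast hs0
  set η : ℝ := s * (2 * (1 + a)) - 1
  have hη0 : 0 < η := by linarith
  set δ : ℝ := η / (8 * s) with hδ
  have hδ0 : 0 < δ := by positivity
  have hsδ : s * δ = η / 8 := by rw [hδ]; field_simp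
  refine dimH_Fset_le_of_eventually ν (ε := η / 4) hs0 (by positivity) ?_
  obtain ⟨N, hN⟩ := exists_nat_ge ((2 + a) / δ)
  filter_upwards [eventually_mul_le_of_lt_liminf ha (sub_lt_self (a : ℝ) hδ0),
    eventually_ge_atTop N] with n hn hnN
  have hnδ : 2 + a ≤ δ * n := by
    have : (N : ℝ) ≤ n := by exact_mod_cast hnN
    rw [mul_comm, ← div_le_iff₀ hδ0]
    linarith
  have hsub : (ν n : ℝ) - 2 ≤ ((ν n - 2 : ℕ) : ℝ) := by
    rw [sub_le_iff_le_add]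
    exact_mod_cast (by omega : ν n ≤ ν n - 2 + 2)
  have hdiv : a - 2 * δ ≤ ((ν n - 2 : ℕ) : ℝ) / (n + 1) := by
    rw [le_div_iff₀ (by positivity)]
    nlinarith
  nlinarith [mul_le_mul_of_nonneg_left hdiv hs0r.le]

/-- The index `j` lies in one of the blocks `[c k, c k + m k)`. -/
def InBlock (c m : ℕ → ℕ) (j : ℕ) : Prop := ∃ k, c k ≤ j ∧ j < c k + m k

open Classical in
/-- The number of indices below `i` that lie in none of the blocks `[c k, c k + m k)`. -/
noncomputable def freeCount (c m : ℕ → ℕ) (i : ℕ) : ℕ :=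
  ((Finset.range i).filter fun j => ¬ InBlock c m j).card

section Blocks

variable {c m : ℕ → ℕ}

theorem freeCount_succ_of_inBlock {i : ℕ} (h : InBlock c m i) :
    freeCount c m (i + 1) = freeCount c m i := by
  simp [freeCount, Finset.range_add_one, Finset.filter_insert, h]

theorem freeCount_succ_of_not_inBlock {i : ℕ} (h : ¬ InBlock c m i) :
    freeCount c m (i + 1) = freeCount c m i + 1 := by
  simp [freeCount, Finset.range_add_one, Finset.filter_insert, h]

open Classical in
theorem freeCount_le (i : ℕ) : freeCount c m i ≤ i :=
  (Finset.card_filter_le _ _).trans (Finset.card_range i).le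

open Classical in
theorem freeCount_mono : Monotone (freeCount c m) := fun _ _ h =>
  Finset.card_le_card (Finset.filter_subset_filter _ (Finset.range_mono h))

theorem sub_le_freeCount {i e : ℕ} (h : ∀ j, e ≤ j → j < i → ¬ InBlock c m j) :
    i - e ≤ freeCount c m i := by
  classical
  rw [← Nat.card_Ico]
  refine Finset.card_le_card fun j hj => ?_
  rw [Finset.mem_Ico] at hj
  exact Finset.mem_filter.2 ⟨Finset.mem_range.2 hj.2, h j hj.1 hj.2⟩

theorem mul_le_freeCount {L : ℕ} (hL : 1 ≤ L) {β : ℝ} (hβ : 0 ≤ β)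
    (hsep : ∀ k, L * (c k + m k) ≤ c (k + 1)) (hm : ∀ k, (m k : ℝ) ≤ β * c k) (i : ℕ) :
    (1 - 1 / L) / (1 + β) * i ≤ freeCount c m i := by
  have hL' : (1 : ℝ) ≤ L := by exact_mod_cast hL
  have hLinv : (1 : ℝ) / L ≤ 1 := (div_le_one (by linarith)).2 hL'
  have hLinv0 : (0 : ℝ) < 1 / L := by positivity
  have hsep' : ∀ k, c k + m k ≤ c (k + 1) := fun k =>
    (Nat.le_mul_of_pos_left _ hL).trans (hsep k)
  have hc : Monotone c := monotone_nat_of_le_succ fun k => (Nat.le_add_right _ _).trans (hsep' k)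
  have hstart : ∀ k, (1 - 1 / L : ℝ) * c k ≤ freeCount c m (c k) := by
    rintro (_ | k)
    · have : c 0 - 0 ≤ freeCount c m (c 0) := sub_le_freeCount fun j _ hj ⟨k, hk, _⟩ =>
        absurd (hc (Nat.zero_le k)) (by omega)
      have h' : (c 0 : ℝ) ≤ freeCount c m (c 0) := by exact_mod_cast this
      nlinarith [(Nat.cast_nonneg (c 0) : (0 : ℝ) ≤ c 0)]
    · have : c (k + 1) - (c k + m k) ≤ freeCount c m (c (k + 1)) := by
        refine sub_le_freeCount fun j hj hj' ⟨l, hl, hl'⟩ => ?_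
        rcases lt_trichotomy l k with h | rfl | h
        · have : c (l + 1) ≤ c k := hc h
          have := hsep' l
          omega
        · omega
        · have : c (k + 1) ≤ c l := hc h
          omega
      have h1 : (c (k + 1) : ℝ) ≤ freeCount c m (c (k + 1)) + (c k + m k) := by
        exact_mod_cast (by omega : c (k + 1) ≤ freeCount c m (c (k + 1)) + (c k + m k))
      have h2 : (c k + m k : ℝ) ≤ 1 / L * c (k + 1) := by
        rw [one_div_mul_eq_div, le_div_iff₀ (by linarith), mul_comm]
        exact_mod_cast hsep k
      linarith
  set θ : ℝ := (1 - 1 / L) / (1 + β) with hθ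
  have hθ0 : 0 ≤ θ := div_nonneg (by linarith) (by linarith)
  have hθ1 : θ ≤ 1 := (div_le_one (by linarith)).2 (by linarith)
  have hθβ : θ * (1 + β) = 1 - 1 / L := div_mul_cancel₀ _ (by linarith)
  induction i with
  | zero => simp
  | succ i ih =>
    by_cases h : InBlock c m i
    · obtain ⟨k, hk, hk'⟩ := h
      have h1 : (freeCount c m (c k) : ℝ) ≤ freeCount c m (i + 1) := by
        exact_mod_cast freeCount_mono (by omega)
      have h2 : ((i + 1 : ℕ) : ℝ) ≤ (1 + β) * c k := by
        have : ((i + 1 : ℕ) : ℝ) ≤ c k + m k := by exact_mod_cast hk'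
        linarith [hm k]
      calc θ * ((i + 1 : ℕ) : ℝ) ≤ θ * ((1 + β) * c k) := mul_le_mul_of_nonneg_left h2 hθ0
        _ = (1 - 1 / L) * c k := by rw [← mul_assoc, hθβ]
        _ ≤ _ := (hstart k).trans h1
    · rw [freeCount_succ_of_not_inBlock h]
      push_cast
      linarith

open Classical in
/-- Number of admissible choices for the `j`-th partial quotient: one inside a block, `(j + 1) ^ q`
outside the blocks. -/
noncomputable def radix (c m : ℕ → ℕ) (q j : ℕ) : ℕ := if InBlock c m j then 1 else (j + 1) ^ q

open Classical in
/-- Smallest admissible value of the `j`-th partial quotient: it increases by one inside a block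
and is `(j + 1) ^ (q + 1)` elsewhere. -/
noncomputable def leastQuotient (c m : ℕ → ℕ) (q : ℕ) : ℕ → ℕ
  | 0 => 1
  | j + 1 => if ∃ k, c k ≤ j ∧ j + 1 < c k + m k then leastQuotient c m q j + 1
      else (j + 2) ^ (q + 1)

theorem radix_pos (q j : ℕ) : 0 < radix c m q j := by
  rw [radix]; split_ifs <;> positivity

theorem radix_le (q j : ℕ) : radix c m q j ≤ (j + 1) ^ q := by
  rw [radix]; split_ifs
  · exact Nat.one_le_pow _ _ (Nat.succ_pos j)
  · exact le_rfl

theorem succ_pow_add_pow_le (q j : ℕ) : (j + 1) ^ (q + 1) + (j + 1) ^ q ≤ (j + 2) ^ (q + 1) := by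
  calc (j + 1) ^ (q + 1) + (j + 1) ^ q = (j + 2) * (j + 1) ^ q := by ring
    _ ≤ (j + 2) * (j + 2) ^ q := by gcongr; omega
    _ = _ := by ring

theorem leastQuotient_le (q j : ℕ) : leastQuotient c m q j ≤ (j + 1) ^ (q + 1) := by
  induction j with
  | zero => simp [leastQuotient]
  | succ j ih =>
    rw [leastQuotient]; split_ifs
    · have := succ_pow_add_pow_le q j
      have : 1 ≤ (j + 1) ^ q := Nat.one_le_pow _ _ (Nat.succ_pos j)
      change _ ≤ (j + 2) ^ (q + 1)
      omega
    · exact le_rfl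

theorem leastQuotient_pos (q j : ℕ) : 0 < leastQuotient c m q j := by
  cases j with
  | zero => simp [leastQuotient]
  | succ j => rw [leastQuotient]; split_ifs <;> positivity

theorem strictMono_leastQuotient_add {q : ℕ} {e : ℕ → ℕ} (he : ∀ j, e j < radix c m q j) :
    StrictMono fun j => leastQuotient c m q j + e j := by
  refine strictMono_nat_of_lt_succ fun j => ?_
  have hj := he j
  rw [leastQuotient]
  split_ifs with h
  · obtain ⟨k, hk, hk'⟩ := h
    rw [radix, if_pos ⟨k, hk, by omega⟩] at hj
    omega
  · have := leastQuotient_le (c := c) (m := m) q j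
    have := radix_le (c := c) (m := m) q j
    have := succ_pow_add_pow_le q j
    omega

theorem leastQuotient_add_lt {q : ℕ} {e : ℕ → ℕ} (he : ∀ j, e j < radix c m q j) (j : ℕ) :
    leastQuotient c m q j + e j + 1 ≤ 3 * (j + 1) ^ (q + 1) := by
  have := leastQuotient_le (c := c) (m := m) q j
  have := radix_le (c := c) (m := m) q j
  have : (j + 1) ^ q ≤ (j + 1) ^ (q + 1) := Nat.pow_le_pow_right (Nat.succ_pos j) (by omega)
  have := he j
  omega

theorem isAPAt_of_block {q : ℕ} {e : ℕ → ℕ} (he : ∀ j, e j < radix c m q j) {a : ℕ → ℕ}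
    (ha : ∀ j, a (j + 1) = leastQuotient c m q j + e j) (k : ℕ) : IsAPAt a (c k + 1) (m k) := by
  refine ⟨1, fun i hi => ?_⟩
  have h0 : ∀ j, InBlock c m j → e j = 0 := fun j hj => by
    have := he j
    rw [radix, if_pos hj] at this
    omega
  rw [show c k + 1 + i + 1 = (c k + i + 1) + 1 by ring, show c k + 1 + i = (c k + i) + 1 by ring,
    ha, ha, h0 _ ⟨k, by omega, by omega⟩, h0 _ ⟨k, by omega, by omega⟩, leastQuotient,
    if_pos ⟨k, by omega, by omega⟩]
  push_cast
  ring

theorem factorial_freeCount_pow_le (q i : ℕ) :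
    (freeCount c m i).factorial ^ q ≤ ∏ j ∈ Finset.range i, radix c m q j := by
  induction i with
  | zero => simp [freeCount]
  | succ i ih =>
    rw [Finset.prod_range_succ, radix]
    split_ifs with h
    · rwa [freeCount_succ_of_inBlock h, mul_one]
    · rw [freeCount_succ_of_not_inBlock h, Nat.factorial_succ, mul_pow, mul_comm]
      gcongr
      exact freeCount_le i

end Blocks

/-- The `j`-th digit of `t` in the mixed radix expansion with radices `M 0, M 1, …`. -/
noncomputable def mixedDigit (M : ℕ → ℕ) (t : ℝ) (j : ℕ) : ℕ :=
  ⌊t * (∏ l ∈ Finset.range (j + 1), M l : ℕ)⌋₊ % M j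

theorem abs_sub_mul_prod_lt_one {M : ℕ → ℕ} (hM : ∀ j, 0 < M j) {t t' : ℝ}
    (ht : t ∈ Ico (0 : ℝ) 1) (ht' : t' ∈ Ico (0 : ℝ) 1) {i : ℕ}
    (h : ∀ j < i, mixedDigit M t j = mixedDigit M t' j) :
    |t - t'| * (∏ l ∈ Finset.range i, M l : ℕ) < 1 := by
  have hfloor : ⌊t * (∏ l ∈ Finset.range i, M l : ℕ)⌋₊ =
      ⌊t' * (∏ l ∈ Finset.range i, M l : ℕ)⌋₊ := by
    induction i with
    | zero => simp [Nat.floor_eq_zero.2 ht.2, Nat.floor_eq_zero.2 ht'.2]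
    | succ i ih =>
      have hdiv : ∀ t : ℝ, ⌊t * (∏ l ∈ Finset.range (i + 1), M l : ℕ)⌋₊ / M i =
          ⌊t * (∏ l ∈ Finset.range i, M l : ℕ)⌋₊ := fun t => by
        have : (M i : ℝ) ≠ 0 := by exact_mod_cast (hM i).ne'
        rw [← Nat.floor_div_natCast, Finset.prod_range_succ, Nat.cast_mul, ← mul_assoc,
          mul_div_cancel_right₀ _ this]
      rw [← Nat.div_add_mod ⌊t * (∏ l ∈ Finset.range (i + 1), M l : ℕ)⌋₊ (M i),
        ← Nat.div_add_mod ⌊t' * (∏ l ∈ Finset.range (i + 1), M l : ℕ)⌋₊ (M i), hdiv, hdiv,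
        ih fun j hj => h j (by omega)]
      congr 1
      exact h i (by omega)
  set P : ℝ := ((∏ l ∈ Finset.range i, M l : ℕ) : ℝ)
  have hP0 : 0 ≤ P := Nat.cast_nonneg _
  have h1 := Nat.floor_le (mul_nonneg ht.1 hP0)
  have h2 := Nat.lt_floor_add_one (t * P)
  have h3 := Nat.floor_le (mul_nonneg ht'.1 hP0)
  have h4 := Nat.lt_floor_add_one (t' * P)
  rw [hfloor] at h1 h2
  rw [← abs_of_nonneg hP0, ← abs_mul, sub_mul, abs_lt]
  constructor <;> linarith

theorem le_dimH_of_abs_sub_le {E : Set ℝ} {g : ℝ → ℝ} {K s : ℝ≥0} (hs : 0 < s)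
    (hg : ∀ t ∈ Ico (0 : ℝ) 1, g t ∈ E)
    (hexp : ∀ t ∈ Ico (0 : ℝ) 1, ∀ t' ∈ Ico (0 : ℝ) 1, |t - t'| ≤ K * |g t - g t'| ^ (s : ℝ)) :
    s ≤ dimH E := by
  have hinj : InjOn g (Ico 0 1) := fun t ht t' ht' h => by
    have := hexp t ht t' ht'
    rw [h, sub_self, abs_zero, Real.zero_rpow (by exact_mod_cast hs.ne'), mul_zero] at this
    exact sub_eq_zero.1 (abs_nonpos_iff.1 this)
  set f := Function.invFunOn g (Ico 0 1)
  have hfg : ∀ t ∈ Ico (0 : ℝ) 1, f (g t) = t := fun t ht => hinj.leftInvOn_invFunOn ht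
  have hholder : HolderOnWith K s f (g '' Ico 0 1) := by
    rintro _ ⟨t, ht, rfl⟩ _ ⟨t', ht', rfl⟩
    rw [hfg t ht, hfg t' ht', edist_dist, edist_dist, Real.dist_eq, Real.dist_eq,
      ENNReal.ofReal_rpow_of_nonneg (abs_nonneg _) s.coe_nonneg, ← ENNReal.ofReal_coe_nnreal,
      ← ENNReal.ofReal_mul K.coe_nonneg]
    exact ENNReal.ofReal_le_ofReal (hexp t ht t' ht')
  have himage : f '' (g '' Ico 0 1) = Ico 0 1 := by
    rw [image_image]
    exact (image_congr hfg).trans (image_id' _)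
  have hone : dimH (Ico (0 : ℝ) 1) = 1 := by
    rw [Real.dimH_of_nonempty_interior (by simp)]
    simp
  have h := hholder.dimH_image_le hs
  rw [himage, hone, ENNReal.le_div_iff_mul_le (Or.inl (by exact_mod_cast hs.ne'))
    (Or.inl ENNReal.coe_ne_top), one_mul] at h
  exact h.trans (dimH_mono (image_subset_iff.2 hg))

theorem mul_log_sub_le_log_factorial {x : ℝ} {u : ℕ} (hx : Real.exp 1 ≤ x) (hxu : x ≤ u) :
    x * (Real.log x - 1) ≤ Real.log u.factorial := by
  have hx0 : 0 < x := (Real.exp_pos 1).trans_le hx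
  have hu0 : (0 : ℝ) < u := hx0.trans_le hxu
  have h1 : 1 ≤ Real.log x := (Real.le_log_iff_exp_le hx0).2 hx
  have h2 : Real.log x ≤ Real.log u := Real.log_le_log hx0 hxu
  have h3 : (u : ℝ) ^ u / Real.exp u ≤ u.factorial := by
    have := Real.pow_div_factorial_le_exp (u : ℝ) hu0.le u
    rw [div_le_iff₀ (by positivity)] at this
    rw [div_le_iff₀ (Real.exp_pos _)]
    linarith
  calc x * (Real.log x - 1) ≤ u * (Real.log u - 1) :=
        mul_le_mul hxu (by linarith) (by linarith) hu0.le
    _ = Real.log ((u : ℝ) ^ u / Real.exp u) := by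
        rw [Real.log_div (by positivity) (Real.exp_pos _).ne', Real.log_pow, Real.log_exp]
        ring
    _ ≤ _ := Real.log_le_log (by positivity) h3

theorem eventually_mul_log_le {θ s : ℝ} (hθ : 0 < θ) (hs : 0 < s) {q : ℕ}
    (hq : 2 * s * (q + 1) < q * θ) :
    ∀ᶠ x : ℝ in atTop, 2 * s * (x + 1) * (Real.log 6 + (q + 1) * Real.log (x + 1)) ≤
      q * (θ * x * (Real.log (θ * x) - 1)) := by
  set η : ℝ := q * θ - 2 * s * (q + 1)
  have hη0 : 0 < η := by linarith
  set C : ℝ := 4 * s * (Real.log 6 + (q + 1) * Real.log 2) + q * θ * |Real.log θ - 1| with hC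
  have hlog : Tendsto Real.log atTop atTop := Real.tendsto_log_atTop
  filter_upwards [eventually_ge_atTop (1 : ℝ), hlog.eventually_ge_atTop (2 * C / η),
    eventually_ge_atTop (4 * s * (q + 1) / η)] with x hx1 hx2 hx3
  have hx0 : 0 < x := by linarith
  set l := Real.log x with hl
  have hl0 : 0 ≤ l := Real.log_nonneg hx1
  have hlogx : Real.log (x + 1) ≤ Real.log 2 + l := by
    rw [hl, ← Real.log_mul (by norm_num) hx0.ne']
    exact Real.log_le_log (by linarith) (by linarith)
  have hlog6 : 0 ≤ Real.log 6 := Real.log_nonneg (by norm_num)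
  have hlog2 : 0 ≤ Real.log 2 := Real.log_nonneg (by norm_num)
  rw [div_le_iff₀ hη0] at hx2 hx3
  rw [Real.log_mul hθ.ne' hx0.ne', ← hl]
  have habs := neg_abs_le (Real.log θ - 1)
  set a := |Real.log θ - 1|
  have hqθ : 0 ≤ q * θ := by positivity
  calc 2 * s * (x + 1) * (Real.log 6 + (q + 1) * Real.log (x + 1))
      ≤ 2 * s * (x + 1) * (Real.log 6 + (q + 1) * (Real.log 2 + l)) := by gcongr
    _ = 2 * s * (x + 1) * (Real.log 6 + (q + 1) * Real.log 2) + 2 * s * (q + 1) * l +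
          2 * s * (q + 1) * (x * l) := by ring
    _ ≤ 4 * s * x * (Real.log 6 + (q + 1) * Real.log 2) + x * η / 2 * l +
          2 * s * (q + 1) * (x * l) := by
        have hsx : 2 * s * (x + 1) ≤ 4 * s * x := by nlinarith
        gcongr ?_ * _ + ?_ * _ + _
        linarith
    _ ≤ q * θ * (x * l) - q * θ * a * x := by
        nlinarith [mul_le_mul_of_nonneg_left hx2 hx0.le]
    _ ≤ q * θ * (x * l) + q * θ * x * (Real.log θ - 1) := by
        nlinarith [mul_le_mul_of_nonneg_left habs (mul_nonneg hqθ hx0.le)]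
    _ = _ := by ring

theorem exists_const_pow_le_mul_factorial {θ s : ℝ} (hθ : 0 < θ) (hs : 0 < s) {q : ℕ}
    (hq : 2 * s * (q + 1) < q * θ) :
    ∃ K : ℝ≥0, ∀ i u : ℕ, θ * i ≤ u →
      ((6 * (i + 1 : ℝ) ^ (q + 1)) ^ (2 * (i + 1))) ^ s ≤ K * (u.factorial : ℝ) ^ q := by
  set F : ℕ → ℝ := fun i => ((6 * (i + 1 : ℝ) ^ (q + 1)) ^ (2 * (i + 1))) ^ s with hF
  have hF0 : ∀ i, 0 < F i := fun i => by positivity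
  have hev : ∀ᶠ i : ℕ in atTop, ∀ u : ℕ, θ * i ≤ u → F i ≤ (u.factorial : ℝ) ^ q := by
    have hlim : Tendsto (fun i : ℕ => θ * (i : ℝ)) atTop atTop :=
      tendsto_natCast_atTop_atTop.const_mul_atTop hθ
    filter_upwards [tendsto_natCast_atTop_atTop.eventually (eventually_mul_log_le hθ hs hq),
      hlim.eventually_ge_atTop (Real.exp 1)] with i hi hi' u hu
    rw [← Real.log_le_log_iff (hF0 i) (by positivity)]
    calc Real.log (F i) = 2 * s * (i + 1) * (Real.log 6 + (q + 1) * Real.log (i + 1)) := by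
          rw [hF, Real.log_rpow (by positivity), Real.log_pow,
            Real.log_mul (by norm_num) (by positivity), Real.log_pow]
          push_cast
          ring
      _ ≤ _ := hi
      _ ≤ q * Real.log u.factorial :=
          mul_le_mul_of_nonneg_left (mul_log_sub_le_log_factorial hi' hu) q.cast_nonneg
      _ = _ := (Real.log_pow _ _).symm
  obtain ⟨N, hN⟩ := eventually_atTop.1 hev
  refine ⟨(1 + ∑ i ∈ Finset.range N, F i).toNNReal, fun i u hu => ?_⟩
  have hsum : 0 ≤ ∑ i ∈ Finset.range N, F i := Finset.sum_nonneg fun i _ => (hF0 i).le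
  have hfac : (1 : ℝ) ≤ (u.factorial : ℝ) ^ q :=
    one_le_pow₀ (by exact_mod_cast u.factorial_pos)
  rw [Real.coe_toNNReal _ (by linarith)]
  change F i ≤ _
  rcases lt_or_ge i N with h | h
  · have := Finset.single_le_sum (f := F) (fun i _ => (hF0 i).le) (Finset.mem_range.2 h)
    nlinarith
  · have := hN i h u hu
    nlinarith

theorem exists_sparse_blocks {ν : ℕ → ℕ} {β : ℝ} (L : ℕ) (hL : 1 ≤ L)
    (h : ∃ᶠ n : ℕ in atTop, (ν (n + 1) : ℝ) ≤ β * n) (hν : ∀ n, 1 ≤ ν n) :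
    ∃ c : ℕ → ℕ, StrictMono c ∧ (∀ k, L * (c k + ν (c k + 1)) ≤ c (k + 1)) ∧
      ∀ k, (ν (c k + 1) : ℝ) ≤ β * c k := by
  choose p hp hpβ using frequently_atTop.1 h
  let c : ℕ → ℕ := fun k => Nat.rec (p 0) (fun _ x => p (L * (x + ν (x + 1)))) k
  have hsep : ∀ k, L * (c k + ν (c k + 1)) ≤ c (k + 1) := fun k => hp _
  refine ⟨c, strictMono_nat_of_lt_succ fun k => ?_, hsep, fun k => ?_⟩
  · have h1 := (Nat.le_mul_of_pos_left _ hL).trans (hsep k)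
    have := hν (c k + 1)
    omega
  · cases k with
    | zero => exact hpβ 0
    | succ k => exact hpβ _

theorem le_dimH_Fset_of_frequently {ν : ℕ → ℕ} (hν : ∀ n, 1 ≤ ν n) {β : ℝ} (hβ : 0 ≤ β)
    (h : ∃ᶠ n : ℕ in atTop, (ν (n + 1) : ℝ) ≤ β * n) {s : ℝ≥0} (hs : 0 < s)
    (hsβ : 2 * s * (1 + β) < 1) : s ≤ dimH (Fset ν) := by
  have hs' : (0 : ℝ) < s := by exact_mod_cast hs
  obtain ⟨L, hL⟩ := exists_nat_gt (1 / (1 - 2 * s * (1 + β)))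
  have hgap : 0 < 1 - 2 * s * (1 + β) := by linarith
  have hL0 : (0 : ℝ) < L := (one_div_pos.2 hgap).trans hL
  have hL1 : 1 ≤ L := by exact_mod_cast hL0
  set θ : ℝ := (1 - 1 / L) / (1 + β) with hθdef
  have hθs : 2 * s < θ := by
    rw [hθdef, lt_div_iff₀ (by linarith)]
    have := (one_div_lt hgap hL0).1 hL
    linarith
  have hθ : 0 < θ := by linarith
  obtain ⟨q, hq⟩ := exists_nat_gt (2 * s / (θ - 2 * s))
  rw [div_lt_iff₀ (by linarith)] at hq
  have hq0 : q ≠ 0 := by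
    rintro rfl
    simp only [Nat.cast_zero, zero_mul] at hq
    linarith
  obtain ⟨K, hK⟩ := exists_const_pow_le_mul_factorial hθ hs' (q := q) (by linarith)
  obtain ⟨c, hc, hsep, hcβ⟩ := exists_sparse_blocks L hL1 h hν
  set m : ℕ → ℕ := fun k => ν (c k + 1)
  have hfree : ∀ i, θ * i ≤ freeCount c m i := mul_le_freeCount hL1 hβ hsep hcβ
  set M := radix c m q
  have hM : ∀ j, 0 < M j := radix_pos q
  have he : ∀ t j, mixedDigit M t j < M j := fun t j => Nat.mod_lt _ (hM j)
  set b : ℝ → ℕ → ℕ := fun t j => leastQuotient c m q j + mixedDigit M t j with hb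
  have hbmono : ∀ t, StrictMono (b t) := fun t => strictMono_leastQuotient_add (he t)
  have hbpos : ∀ t j, 0 < b t j := fun t j => Nat.add_pos_left (leastQuotient_pos q j) _
  have hb2 : ∀ t j, 2 ≤ b t (j + 1) := fun t j =>
    (Nat.succ_le_of_lt (hbpos t j)).trans_lt (hbmono t j.lt_succ_self)
  choose y hy using fun t => exists_isTails (b t) (hbpos t)
  refine le_dimH_of_abs_sub_le (g := fun t => y t 0) (K := K) hs (fun t _ => ?_) ?_
  · refine ⟨⟨⟨(hy t).pos 0, (hy t).lt_one 0⟩, (hy t).irrational, fun n hn => ?_⟩, fun N => ?_⟩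
    · obtain ⟨n, rfl⟩ := Nat.exists_eq_add_of_le' hn
      rw [(hy t).pq_eq, (hy t).pq_eq]
      exact hbmono t n.lt_succ_self
    · exact ⟨c N + 1, (hc.id_le N).trans (Nat.le_succ _), by omega,
        isAPAt_of_block (he t) (hy t).pq_eq N⟩
  · intro t ht t' ht'
    have hclose : ∀ i, (∀ j < i, mixedDigit M t j = mixedDigit M t' j) →
        |t - t'| * ((freeCount c m i).factorial : ℝ) ^ q < 1 := fun i hi => by
      refine lt_of_le_of_lt (mul_le_mul_of_nonneg_left ?_ (abs_nonneg _))
        (abs_sub_mul_prod_lt_one hM ht ht' hi)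
      exact_mod_cast factorial_freeCount_pow_le q i
    rcases eq_or_ne t t' with rfl | hne
    · simp [hs.ne']
    have hdist : 0 < |t - t'| := abs_pos.2 (sub_ne_zero.2 hne)
    have hex : ∃ j, mixedDigit M t j ≠ mixedDigit M t' j := by
      by_contra! hall
      obtain ⟨i, hi⟩ := exists_nat_ge (1 / |t - t'| / θ)
      have h1 := hclose i fun j _ => hall j
      have h2 : (freeCount c m i : ℝ) ≤ ((freeCount c m i).factorial : ℝ) ^ q := by
        exact_mod_cast (Nat.self_le_factorial _).trans (Nat.le_self_pow hq0 _)
      have h3 : 1 / |t - t'| ≤ ((freeCount c m i).factorial : ℝ) ^ q := by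
        rw [div_le_iff₀ hθ] at hi
        linarith [hfree i]
      rw [div_le_iff₀ hdist] at h3
      linarith
    classical
    set i := Nat.find hex
    have hlt : ∀ j < i, mixedDigit M t j = mixedDigit M t' j := fun j hj =>
      not_not.1 (Nat.find_min hex hj)
    have hbound : ∀ t, ∀ j ≤ i, (b t j + 1 : ℝ) ≤ 3 * (i + 1 : ℝ) ^ (q + 1) := fun t j hj => by
      have h1 := leastQuotient_add_lt (he t) j
      have h2 : 3 * (j + 1) ^ (q + 1) ≤ 3 * (i + 1) ^ (q + 1) := by gcongr
      exact_mod_cast h1.trans h2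
    have hlow := (hy t).le_abs_sub (hy t') i (fun j hj => by simp only [hb, hlt j hj])
      (by simpa only [hb, ne_eq, Nat.add_left_cancel_iff] using Nat.find_spec hex) (hb2 t i)
      (hb2 t' i) _ (by positivity) (hbound t) (hbound t')
    set W : ℝ := (6 * (i + 1 : ℝ) ^ (q + 1)) ^ (2 * (i + 1)) with hW
    have hW0 : 0 < W := by positivity
    have hWlow : 1 / W ≤ |y t 0 - y t' 0| := by
      refine le_trans ?_ hlow
      rw [hW, ← one_div_pow,
        show 1 / (6 * (i + 1 : ℝ) ^ (q + 1)) = 1 / 2 * (1 / (3 * (i + 1 : ℝ) ^ (q + 1))) by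
          field_simp; norm_num, mul_pow]
      gcongr
      exact pow_le_of_le_one (by norm_num) (by norm_num) (by omega)
    have hfac : (0 : ℝ) < ((freeCount c m i).factorial : ℝ) ^ q := by positivity
    have hKi := hK i _ (hfree i)
    calc |t - t'| ≤ 1 / ((freeCount c m i).factorial : ℝ) ^ q :=
          ((lt_div_iff₀ hfac).2 (hclose i hlt)).le
      _ ≤ K * (1 / W) ^ (s : ℝ) := by
          rw [Real.div_rpow zero_le_one hW0.le, Real.one_rpow, mul_one_div,
            div_le_div_iff₀ hfac (by positivity), one_mul]
          exact hKi
      _ ≤ K * |y t 0 - y t' 0| ^ (s : ℝ) := by gcongr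

theorem le_dimH_Fset {ν : ℕ → ℕ} (hν : ∀ n, 1 ≤ ν n) {a : ℝ≥0}
    (ha : (a : ℝ≥0∞) = liminf (fun n : ℕ => (ν n : ℝ≥0∞) / (n : ℝ≥0∞)) atTop) :
    ((1 / (2 * (1 + a)) : ℝ≥0) : ℝ≥0∞) ≤ dimH (Fset ν) := by
  refine ENNReal.le_of_forall_nnreal_lt fun s hs => ?_
  rcases eq_or_ne s 0 with rfl | hs0
  · simp
  have hs1 : s < 1 / (2 * (1 + a)) := by exact_mod_cast hs
  have hspos : (0 : ℝ) < s := by exact_mod_cast pos_iff_ne_zero.2 hs0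
  have hsr : (s : ℝ) * (2 * (1 + a)) < 1 := by
    have : s * (2 * (1 + a)) < 1 := by rwa [lt_div_iff₀ (by positivity)] at hs1
    exact_mod_cast this
  set δ : ℝ := (1 - s * (2 * (1 + a))) / (8 * s) with hδ
  have hδ0 : 0 < δ := div_pos (by linarith) (by linarith)
  have hsδ : s * δ = (1 - s * (2 * (1 + a))) / 8 := by rw [hδ]; field_simp
  refine le_dimH_Fset_of_frequently hν (β := a + 2 * δ) (by positivity) ?_
    (pos_iff_ne_zero.2 hs0) (by nlinarith)
  obtain ⟨N, hN⟩ := exists_nat_ge ((a + δ) / δ)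
  rw [div_le_iff₀ hδ0] at hN
  have hfreq := frequently_le_mul_of_liminf_lt ha (lt_add_of_pos_right (a : ℝ) hδ0)
  rw [frequently_atTop] at hfreq ⊢
  intro n₀
  obtain ⟨n, hn, hnν⟩ := hfreq (max n₀ N + 1)
  obtain ⟨n, rfl⟩ := Nat.exists_eq_add_of_le' (le_of_add_le_right hn)
  refine ⟨n, by omega, hnν.trans ?_⟩
  have : (N : ℝ) ≤ n := by exact_mod_cast (by omega : N ≤ n)
  push_cast
  nlinarith

/-- Theorem 1.1 (case `α < ∞`): the Hausdorff dimension of the `F`-set equals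
`1/(2(1+α))` where `α = liminf ν_n / n`. -/
theorem stmt0 (ν : ℕ → ℕ) (hν1 : ∀ n, 1 ≤ ν n) (hmono : Monotone ν)
    (α : ℝ≥0∞) (hα : α = Filter.liminf (fun n : ℕ => (ν n : ℝ≥0∞) / (n : ℝ≥0∞)) Filter.atTop)
    (hfin : α ≠ ⊤) :
    dimH (Fset ν) = 1 / (2 * (1 + α)) := by
  lift α to ℝ≥0 using hfin
  have h : (1 / (2 * (1 + α)) : ℝ≥0∞) = ((1 / (2 * (1 + α)) : ℝ≥0) : ℝ≥0∞) := by
    rw [ENNReal.coe_div (by positivity)]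
    push_cast
    rfl
  rw [h]
  exact le_antisymm (dimH_Fset_le hα) (le_dimH_Fset hν1 hα)
end

section
/- Let (σ_n)_{n≥1} be a strictly increasing sequence of positive integers with σ_{n+1} − σ_n ≥ n for all n ≥ 1 and such that (σ_{n+1} − σ_n)/n → ∞ as n → ∞. Then the Hausdorff dimension of G((σ_n)) equals 1/2. -/
open Filter MeasureTheory Set
open scoped ENNReal NNReal Topology

/-- `u` is the sequence of complete quotients (all in `(0,1)`) with digit sequence `a`:
`u i = 1 / (a i + u (i + 1))`. -/
def IsCFOrbit (a : ℕ → ℕ) (u : ℕ → ℝ) : Prop :=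
  ∀ i, u i ∈ Ioo (0 : ℝ) 1 ∧ 1 / u i = a i + u (i + 1)

namespace IsCFOrbit

variable {a b : ℕ → ℕ} {u v : ℕ → ℝ}

theorem gaussMap_eq (h : IsCFOrbit a u) (i : ℕ) : gaussMap (u i) = u (i + 1) := by
  have h1 := (h (i + 1)).1
  have h2 : ⌊(a i : ℝ) + u (i + 1)⌋ = a i := by
    rw [Int.floor_eq_iff]
    push_cast
    exact ⟨by linarith [h1.1], by linarith [h1.2]⟩
  rw [gaussMap, (h i).2, h2]
  push_cast
  ring

theorem gaussMap_iterate (h : IsCFOrbit a u) (i : ℕ) : gaussMap^[i] (u 0) = u i := by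
  induction i with
  | zero => rfl
  | succ i ih => rw [Function.iterate_succ_apply', ih, h.gaussMap_eq]

theorem pq_eq (h : IsCFOrbit a u) (i : ℕ) : pq (u 0) (i + 1) = a i := by
  have h1 := (h (i + 1)).1
  have h2 : ⌊(a i : ℝ) + u (i + 1)⌋ = a i := by
    rw [Int.floor_eq_iff]
    push_cast
    exact ⟨by linarith [h1.1], by linarith [h1.2]⟩
  rw [pq, Nat.add_sub_cancel, h.gaussMap_iterate, (h i).2, h2]
  rfl

theorem irrational (h : IsCFOrbit a u) : Irrational (u 0) := by
  have key : ∀ n : ℕ, 0 < n → ∀ i : ℕ, ∀ p : ℤ, u i * n ≠ p := by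
    intro n
    induction n using Nat.strong_induction_on with
    | _ n ih =>
      intro hn i p hp
      have hn' : (0 : ℝ) < n := by exact_mod_cast hn
      obtain ⟨⟨h0, h1⟩, h2⟩ := h i
      have hp0 : (0 : ℝ) < p := by rw [← hp]; positivity
      have hpn : (p : ℝ) < n := by rw [← hp]; nlinarith
      have hp0' : 0 < p := by exact_mod_cast hp0
      obtain ⟨m, rfl⟩ : ∃ m : ℕ, p = m := ⟨p.toNat, by omega⟩
      push_cast at hp hpn
      refine ih m (by exact_mod_cast hpn) (by omega) (i + 1) ((n : ℤ) - a i * m) ?_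
      have h3 : u (i + 1) = 1 / u i - a i := by linarith
      push_cast
      rw [h3, ← hp]
      field_simp
  rintro ⟨q, hq⟩
  refine key q.den q.den_pos 0 q.num ?_
  rw [← hq]
  exact_mod_cast Rat.mul_den_eq_num q

theorem abs_sub_eq (h : IsCFOrbit a u) (h' : IsCFOrbit b v) (i : ℕ) :
    |u i - v i| = u i * v i * |(a i + u (i + 1)) - (b i + v (i + 1))| := by
  obtain ⟨⟨h0, -⟩, h2⟩ := h i
  obtain ⟨⟨h0', -⟩, h2'⟩ := h' i
  rw [← h2, ← h2', abs_sub_comm]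
  nth_rewrite 2 [← abs_of_pos h0]
  nth_rewrite 2 [← abs_of_pos h0']
  rw [← abs_mul, ← abs_mul]
  congr 1
  field_simp

theorem le_inv (h : IsCFOrbit a u) {m : ℕ} (hm : 0 < m) {i : ℕ} (ha : m ≤ a i) :
    u i ≤ 1 / m := by
  obtain ⟨⟨h0, -⟩, h2⟩ := h i
  have hm' : (0 : ℝ) < m := by exact_mod_cast hm
  have ha' : (m : ℝ) ≤ a i := by exact_mod_cast ha
  have := (h (i + 1)).1.1
  rw [le_div_iff₀ hm']
  rw [div_eq_iff h0.ne'] at h2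
  nlinarith

theorem inv_le (h : IsCFOrbit a u) {m : ℕ} {i : ℕ} (ha : a i < m) : 1 / (m : ℝ) ≤ u i := by
  obtain ⟨⟨h0, -⟩, h2⟩ := h i
  have ha' : (a i : ℝ) + 1 ≤ m := by exact_mod_cast ha
  have hm' : (0 : ℝ) < m := by have : (0 : ℝ) ≤ a i := by positivity
                               linarith
  have := (h (i + 1)).1.2
  rw [div_le_iff₀ hm']
  rw [div_eq_iff h0.ne'] at h2
  nlinarith

theorem abs_sub_le_prod (h : IsCFOrbit a u) (h' : IsCFOrbit b v) {m : ℕ → ℕ} (n : ℕ)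
    (hab : ∀ i < n, a i = b i) (hm : ∀ i < n, 0 < m i ∧ m i ≤ a i) :
    |u 0 - v 0| ≤ ∏ i ∈ Finset.range n, (1 / (m i : ℝ)) ^ 2 := by
  suffices H : |u 0 - v 0| ≤ (∏ i ∈ Finset.range n, (1 / (m i : ℝ)) ^ 2) * |u n - v n| by
    refine H.trans (mul_le_of_le_one_right (by positivity) ?_)
    obtain ⟨⟨h0, h1⟩, -⟩ := h n
    obtain ⟨⟨h0', h1'⟩, -⟩ := h' n
    rw [abs_le]
    constructor <;> linarith
  induction n with
  | zero => simp
  | succ n ih =>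
    have hlt : n < n + 1 := Nat.lt_succ_self n
    refine (ih (fun i hi => hab i (hi.trans hlt)) (fun i hi => hm i (hi.trans hlt))).trans ?_
    rw [Finset.prod_range_succ, mul_assoc]
    refine mul_le_mul_of_nonneg_left ?_ (by positivity)
    have hu := h.le_inv (hm n hlt).1 (hm n hlt).2
    have hv := h'.le_inv (hm n hlt).1 (hab n hlt ▸ (hm n hlt).2)
    rw [h.abs_sub_eq h' n, hab n hlt, add_sub_add_left_eq_sub, sq]
    have := (h' n).1.1
    gcongr

theorem prod_le_abs_sub (h : IsCFOrbit a u) (h' : IsCFOrbit b v) {m : ℕ → ℕ} (n : ℕ)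
    (hab : ∀ i < n, a i = b i) (hm : ∀ i < n, a i < m i) :
    (∏ i ∈ Finset.range n, (1 / (m i : ℝ)) ^ 2) * |u n - v n| ≤ |u 0 - v 0| := by
  induction n with
  | zero => simp
  | succ n ih =>
    have hlt : n < n + 1 := Nat.lt_succ_self n
    refine le_trans ?_ (ih (fun i hi => hab i (hi.trans hlt)) (fun i hi => hm i (hi.trans hlt)))
    rw [Finset.prod_range_succ, mul_assoc]
    refine mul_le_mul_of_nonneg_left ?_ (by positivity)
    have hu := h.inv_le (hm n hlt)
    have hv := h'.inv_le (hab n hlt ▸ hm n hlt)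
    rw [h.abs_sub_eq h' n, hab n hlt, add_sub_add_left_eq_sub, sq]
    have := (h n).1.1
    gcongr

end IsCFOrbit

theorem irrational_gaussMap {x : ℝ} (hx : Irrational x) : Irrational (gaussMap x) := by
  rw [gaussMap, one_div]
  exact hx.inv.sub_intCast _

theorem Irrational.gaussMap_mem {x : ℝ} (hx : Irrational x) : gaussMap x ∈ Ioo (0 : ℝ) 1 := by
  refine ⟨lt_of_le_of_ne (Int.fract_nonneg (1 / x)) ?_, Int.fract_lt_one (1 / x)⟩
  simpa using ((irrational_gaussMap hx).ne_int 0).symm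

/-- The Gauss orbit of an irrational point of `(0,1)` is a continued fraction orbit. -/
theorem isCFOrbit_gaussMap {x : ℝ} (h01 : x ∈ Ioo (0 : ℝ) 1) (hx : Irrational x) :
    IsCFOrbit (fun i => pq x (i + 1)) (fun i => gaussMap^[i] x) := by
  have hirr : ∀ i, Irrational (gaussMap^[i] x) := by
    intro i
    induction i with
    | zero => exact hx
    | succ i ih => rw [Function.iterate_succ_apply']; exact irrational_gaussMap ih
  have hmem : ∀ i, gaussMap^[i] x ∈ Ioo (0 : ℝ) 1 := by
    rintro (_ | i)
    · exact h01
    · rw [Function.iterate_succ_apply']; exact (hirr i).gaussMap_mem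
  refine fun i => ⟨hmem i, ?_⟩
  have hpos : 0 ≤ ⌊1 / gaussMap^[i] x⌋ :=
    Int.floor_nonneg.2 (one_div_nonneg.2 (hmem i).1.le)
  have hcast : ((⌊1 / gaussMap^[i] x⌋.toNat : ℕ) : ℝ) = (⌊1 / gaussMap^[i] x⌋ : ℝ) := by
    exact_mod_cast Int.toNat_of_nonneg hpos
  simp only [pq, Nat.add_sub_cancel, Function.iterate_succ_apply']
  rw [hcast, gaussMap]
  ring

theorem tendsto_prod_range_of_tendsto_zero {c : ℕ → ℝ} (h0 : ∀ i, 0 ≤ c i)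
    (hc : Tendsto c atTop (𝓝 0)) :
    Tendsto (fun n => ∏ i ∈ Finset.range n, c i) atTop (𝓝 0) := by
  refine (summable_of_ratio_norm_eventually_le (r := 1 / 2) (by norm_num) ?_).tendsto_atTop_zero
  filter_upwards [hc.eventually (gt_mem_nhds (show (0 : ℝ) < 1 / 2 by norm_num))] with n hn
  have hp : 0 ≤ ∏ i ∈ Finset.range n, c i := Finset.prod_nonneg fun i _ => h0 i
  rw [Finset.prod_range_succ, norm_mul, mul_comm, Real.norm_of_nonneg (h0 n)]
  gcongr

theorem ENNReal.tsum_pi_fin_prod (n : ℕ) (g : ℕ → ℕ → ℝ≥0∞) :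
    ∑' f : Fin n → ℕ, ∏ i : Fin n, g i (f i) = ∏ i ∈ Finset.range n, ∑' k, g i k := by
  induction n generalizing g with
  | zero => simp
  | succ n ih =>
    rw [← (Fin.consEquiv fun _ : Fin (n + 1) => ℕ).tsum_eq, ENNReal.tsum_prod',
      Finset.prod_range_succ', mul_comm, ← ENNReal.tsum_mul_right]
    refine tsum_congr fun k => ?_
    rw [← ih fun i => g (i + 1), ← ENNReal.tsum_mul_left]
    refine tsum_congr fun f => ?_
    simp [Fin.prod_univ_succ, Fin.consEquiv]

theorem lt_pq_of_mem_Jset {x : ℝ} (hx : x ∈ Jset) (i : ℕ) : i + 1 ≤ pq x (i + 1) := by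
  have h := isCFOrbit_gaussMap hx.1 hx.2.1
  induction i with
  | zero =>
    by_contra! h0
    obtain ⟨⟨h1, h2⟩, h3⟩ := h 0
    have h4 := (h 1).1.2
    have h0' : pq x (0 + 1) = 0 := by omega
    simp only [h0'] at h3
    have : 1 < 1 / gaussMap^[0] x := by rwa [lt_one_div one_pos h1, div_one]
    rw [h3] at this
    simp only [Nat.cast_zero, zero_add] at this
    linarith
  | succ i ih => exact lt_of_le_of_lt ih (hx.2.2 (i + 1) (by omega))

theorem hausdorffMeasure_Jset {s : ℝ} (hs : 1 / 2 < s) : μH[s] Jset = 0 := by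
  have hs0 : 0 < s := by linarith
  let q : ℕ → ℝ := fun k => ((1 / (k : ℝ)) ^ 2) ^ s
  have hq0 : ∀ k, 0 ≤ q k := fun k => by positivity
  have hq : Summable q := by
    have : Summable fun n : ℕ => ((n : ℝ) ^ (2 * s))⁻¹ :=
      Real.summable_nat_rpow_inv.2 (by linarith)
    refine this.congr fun k => ?_
    simp only [q]
    rw [one_div, inv_pow, Real.inv_rpow (by positivity), ← Real.rpow_natCast,
      ← Real.rpow_mul (by positivity)]
    norm_num
  let t : ∀ n : ℕ, (Fin n → ℕ) → Set ℝ := fun n f =>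
    {x | x ∈ Jset ∧ ∀ i : Fin n, pq x (i + 1) = i + 1 + f i}
  have hdiam : ∀ n f, Metric.ediam (t n f) ≤
      ENNReal.ofReal (∏ i : Fin n, (1 / ((f i + (i + 1) : ℕ) : ℝ)) ^ 2) := by
    refine fun n f => Metric.ediam_le fun x hx y hy => ?_
    rw [edist_dist, Real.dist_eq]
    refine ENNReal.ofReal_le_ofReal ?_
    have := (isCFOrbit_gaussMap hx.1.1 hx.1.2.1).abs_sub_le_prod
      (isCFOrbit_gaussMap hy.1.1 hy.1.2.1) (m := fun i => pq x (i + 1)) n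
      (fun i hi => (hx.2 ⟨i, hi⟩).trans (hy.2 ⟨i, hi⟩).symm)
      (fun i hi => ⟨by have := lt_pq_of_mem_Jset hx.1 i; omega, le_rfl⟩)
    rw [← Fin.prod_univ_eq_prod_range (fun i => (1 / (pq x (i + 1) : ℝ)) ^ 2)] at this
    refine this.trans_eq (Finset.prod_congr rfl fun i _ => ?_)
    rw [hx.2 i, add_comm]
  have hr : Tendsto (fun n : ℕ => ENNReal.ofReal (∏ i ∈ Finset.range n, (1 / ((i : ℝ) + 1)) ^ 2))
      atTop (𝓝 0) := by
    rw [← ENNReal.ofReal_zero]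
    refine ENNReal.tendsto_ofReal (tendsto_prod_range_of_tendsto_zero (fun i => by positivity) ?_)
    simpa using (tendsto_one_div_add_atTop_nhds_zero_nat (𝕜 := ℝ)).pow 2
  have hbound := Measure.hausdorffMeasure_le_liminf_tsum s Jset _ hr t
    (Eventually.of_forall fun n f => (hdiam n f).trans (ENNReal.ofReal_le_ofReal (by
      rw [← Fin.prod_univ_eq_prod_range fun i : ℕ => (1 / ((i : ℝ) + 1)) ^ 2]
      refine Finset.prod_le_prod (fun i _ => by positivity) fun i _ => ?_
      gcongr
      push_cast
      linarith [(f i).cast_nonneg (α := ℝ)])))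
    (Eventually.of_forall fun n x hx => mem_iUnion.2
      ⟨fun i => pq x (i + 1) - (i + 1), hx, fun i => by
        exact (Nat.add_sub_cancel' (lt_pq_of_mem_Jset hx i)).symm⟩)
  refine le_antisymm (hbound.trans ?_) zero_le
  have hlim : Tendsto
      (fun n => ENNReal.ofReal (∏ i ∈ Finset.range n, ∑' k, q (k + (i + 1)))) atTop (𝓝 0) := by
    rw [← ENNReal.ofReal_zero]
    exact ENNReal.tendsto_ofReal (tendsto_prod_range_of_tendsto_zero
      (fun i => tsum_nonneg fun k => hq0 _)
      ((tendsto_sum_nat_add q).comp (tendsto_add_atTop_nat 1)))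
  rw [← hlim.liminf_eq]
  refine liminf_le_liminf (Eventually.of_forall fun n => ?_)
  rw [ENNReal.ofReal_prod_of_nonneg fun i _ => tsum_nonneg fun k => hq0 _]
  have : ∀ i, ENNReal.ofReal (∑' k, q (k + (i + 1))) = ∑' k, ENNReal.ofReal (q (k + (i + 1))) :=
    fun i => ENNReal.ofReal_tsum_of_nonneg (fun k => hq0 _)
      ((summable_nat_add_iff (i + 1)).2 hq)
  simp only [this]
  rw [← ENNReal.tsum_pi_fin_prod n fun i k => ENNReal.ofReal (q (k + (i + 1)))]
  refine ENNReal.tsum_le_tsum fun f => (ENNReal.rpow_le_rpow (hdiam n f) hs0.le).trans_eq ?_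
  rw [ENNReal.ofReal_rpow_of_nonneg (by positivity) hs0.le,
    ← Real.finsetProd_rpow _ _ (fun i _ => by positivity),
    ENNReal.ofReal_prod_of_nonneg fun i _ => by positivity]

theorem dimH_Jset_le : dimH Jset ≤ 1 / 2 := by
  refine le_of_forall_gt_imp_ge_of_dense fun d hd => ?_
  rcases eq_or_ne d ⊤ with rfl | hd'
  · exact le_top
  lift d to ℝ≥0 using hd'
  refine dimH_le_of_hausdorffMeasure_ne_top ?_
  rw [hausdorffMeasure_Jset]
  · simp
  · have : ((1 / 2 : ℝ≥0) : ℝ≥0∞) < d := by simpa using hd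
    have h2 : (1 / 2 : ℝ≥0) < d := by exact_mod_cast this
    exact_mod_cast h2

/-- The `n`-th approximations `1 / (a i + 1 / (a (i + 1) + ⋯))` of the tails of a continued
fraction. -/
noncomputable def cfApprox (a : ℕ → ℕ) : ℕ → ℕ → ℝ
  | 0, _ => 0
  | n + 1, i => 1 / (a i + cfApprox a n (i + 1))

theorem cfApprox_nonneg (a : ℕ → ℕ) (n i : ℕ) : 0 ≤ cfApprox a n i := by
  induction n generalizing i with
  | zero => exact le_rfl
  | succ n ih => exact one_div_nonneg.2 (add_nonneg (Nat.cast_nonneg _) (ih _))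

theorem abs_cfApprox_sub_le {a : ℕ → ℕ} (ha : ∀ i, 2 ≤ a i) (n i : ℕ) :
    |cfApprox a n i - cfApprox a (n + 1) i| ≤ 1 * (1 / 4) ^ n := by
  have ha' : ∀ i, (2 : ℝ) ≤ a i := fun i => by exact_mod_cast ha i
  induction n generalizing i with
  | zero =>
    simp only [cfApprox, add_zero, zero_sub, abs_neg, pow_zero, mul_one]
    rw [abs_of_nonneg (by positivity), div_le_one (by linarith [ha' i])]
    linarith [ha' i]
  | succ n ih =>
    have h1 := cfApprox_nonneg a n (i + 1)
    have h2 := cfApprox_nonneg a (n + 1) (i + 1)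
    have h3 := ha' i
    have h4 := ih (i + 1)
    rw [cfApprox, cfApprox, div_sub_div _ _ (by linarith) (by linarith), abs_div,
      div_le_iff₀ (by rw [abs_pos]; positivity)]
    rw [abs_of_nonneg (a := _ * _) (by positivity), one_mul, mul_one, add_sub_add_left_eq_sub,
      abs_sub_comm]
    have h5 : (4 : ℝ) ≤ (a i + cfApprox a n (i + 1)) * (a i + cfApprox a (n + 1) (i + 1)) := by
      nlinarith
    calc _ ≤ 1 * (1 / 4 : ℝ) ^ n := h4
      _ = 1 * (1 / 4 : ℝ) ^ (n + 1) * 4 := by ring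
      _ ≤ _ := by gcongr

theorem exists_isCFOrbit {a : ℕ → ℕ} (ha : ∀ i, 2 ≤ a i) : ∃ u, IsCFOrbit a u := by
  have hcau : ∀ i, CauchySeq fun n => cfApprox a n i := fun i =>
    cauchySeq_of_le_geometric (1 / 4) 1 (by norm_num) fun n => abs_cfApprox_sub_le ha n i
  choose u hu using fun i => cauchySeq_tendsto_of_complete (hcau i)
  have ha' : ∀ i, (2 : ℝ) ≤ a i := fun i => by exact_mod_cast ha i
  have h0 : ∀ i, 0 ≤ u i := fun i => ge_of_tendsto' (hu i) fun n => cfApprox_nonneg a n i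
  have heq : ∀ i, u i = 1 / (a i + u (i + 1)) := fun i => by
    refine tendsto_nhds_unique ((hu i).comp (tendsto_add_atTop_nat 1)) ?_
    exact tendsto_const_nhds.div ((hu (i + 1)).const_add _)
      (ne_of_gt (by linarith [ha' i, h0 (i + 1)]))
  refine ⟨u, fun i => ⟨⟨?_, ?_⟩, ?_⟩⟩
  · rw [heq]
    have := ha' i
    have := h0 (i + 1)
    positivity
  · rw [heq, div_lt_one (by linarith [ha' i, h0 (i + 1)])]
    linarith [ha' i, h0 (i + 1)]
  · rw [heq, one_div_one_div]

/-- The remainders left over when `y` is read off in binary, in blocks of `w i` bits. -/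
noncomputable def bitRemainder (w : ℕ → ℕ) (y : ℝ) : ℕ → ℝ
  | 0 => y
  | i + 1 => Int.fract (2 ^ w i * bitRemainder w y i)

/-- The `i`-th block of `w i` bits of `y`. -/
noncomputable def bitBlock (w : ℕ → ℕ) (y : ℝ) (i : ℕ) : ℕ := ⌊2 ^ w i * bitRemainder w y i⌋₊

theorem bitRemainder_mem (w : ℕ → ℕ) {y : ℝ} (hy : y ∈ Ico (0 : ℝ) 1) (i : ℕ) :
    bitRemainder w y i ∈ Ico (0 : ℝ) 1 := by
  cases i with
  | zero => exact hy
  | succ i => exact ⟨Int.fract_nonneg _, Int.fract_lt_one _⟩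

theorem bitBlock_lt (w : ℕ → ℕ) {y : ℝ} (hy : y ∈ Ico (0 : ℝ) 1) (i : ℕ) :
    bitBlock w y i < 2 ^ w i := by
  obtain ⟨h0, h1⟩ := bitRemainder_mem w hy i
  rw [bitBlock, Nat.floor_lt (by positivity)]
  push_cast
  exact mul_lt_of_lt_one_right (by positivity) h1

theorem bitRemainder_succ (w : ℕ → ℕ) {y : ℝ} (hy : y ∈ Ico (0 : ℝ) 1) (i : ℕ) :
    bitRemainder w y (i + 1) = 2 ^ w i * bitRemainder w y i - bitBlock w y i := by
  obtain ⟨h0, -⟩ := bitRemainder_mem w hy i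
  rw [bitRemainder, bitBlock, ← Int.self_sub_floor, natCast_floor_eq_intCast_floor (by positivity)]

theorem abs_sub_le_of_bitBlock_eq (w : ℕ → ℕ) {y z : ℝ} (hy : y ∈ Ico (0 : ℝ) 1)
    (hz : z ∈ Ico (0 : ℝ) 1) (n : ℕ) (h : ∀ i < n, bitBlock w y i = bitBlock w z i) :
    |y - z| ≤ (1 / 2) ^ ∑ i ∈ Finset.range n, w i := by
  have key : bitRemainder w y n - bitRemainder w z n
      = 2 ^ (∑ i ∈ Finset.range n, w i) * (y - z) := by
    induction n with
    | zero => simp [bitRemainder]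
    | succ n ih =>
      rw [bitRemainder_succ w hy, bitRemainder_succ w hz, h n n.lt_succ_self,
        sub_sub_sub_cancel_right, ← mul_sub, ih fun i hi => h i (hi.trans n.lt_succ_self),
        Finset.sum_range_succ, pow_add]
      ring
  obtain ⟨h0, h1⟩ := bitRemainder_mem w hy n
  obtain ⟨h0', h1'⟩ := bitRemainder_mem w hz n
  rw [one_div, inv_pow, ← one_div, le_div_iff₀ (by positivity), mul_comm]
  rw [← abs_of_pos (show (0 : ℝ) < 2 ^ ∑ i ∈ Finset.range n, w i by positivity), ← abs_mul, ← key,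
    abs_le]
  constructor <;> linarith

/-- If the digits `a i`, `b i` are at least `2`, less than `2 ^ (i + 2)` and first differ at
`i = n`, then the corresponding points are not too close. -/
theorem IsCFOrbit.pow_le_abs_sub {a b : ℕ → ℕ} {u v : ℕ → ℝ} (h : IsCFOrbit a u)
    (h' : IsCFOrbit b v) (ha : ∀ i, 2 ≤ a i ∧ a i < 2 ^ (i + 2))
    (hb : ∀ i, 2 ≤ b i ∧ b i < 2 ^ (i + 2)) (n : ℕ) (hab : ∀ i < n, a i = b i)
    (hn : a n ≠ b n) : (1 / 2 : ℝ) ^ (n ^ 2 + 5 * n + 5) ≤ |u 0 - v 0| := by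
  have hprod : ∏ i ∈ Finset.range n, (1 / ((2 ^ (i + 2) : ℕ) : ℝ)) ^ 2
      = (1 / 2 : ℝ) ^ (n ^ 2 + 3 * n) := by
    clear hab hn
    induction n with
    | zero => simp
    | succ n ih =>
      rw [Finset.prod_range_succ, ih]
      push_cast
      rw [← one_div_pow, ← pow_mul, ← pow_add]
      congr 1
      ring
  have hdig : (1 / 2 : ℝ) ^ (2 * n + 5) ≤ |u n - v n| := by
    have hu := h.inv_le (ha n).2
    have hv := h'.inv_le (hb n).2
    have hu1 := h.le_inv two_pos (ha (n + 1)).1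
    have hv1 := h'.le_inv two_pos (hb (n + 1)).1
    have hu0 := (h (n + 1)).1.1
    have hv0 := (h' (n + 1)).1.1
    have hgap : (1 / 2 : ℝ) ≤ |(a n + u (n + 1)) - (b n + v (n + 1))| := by
      push_cast at hu1 hv1
      rcases hn.lt_or_gt with hlt | hlt
      · have : (a n : ℝ) + 1 ≤ b n := by exact_mod_cast hlt
        rw [abs_sub_comm]
        exact le_trans (by linarith) (le_abs_self _)
      · have : (b n : ℝ) + 1 ≤ a n := by exact_mod_cast hlt
        exact le_trans (by linarith) (le_abs_self _)
    rw [h.abs_sub_eq h' n]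
    have := (h n).1.1
    have := (h' n).1.1
    calc (1 / 2 : ℝ) ^ (2 * n + 5)
        = 1 / ((2 ^ (n + 2) : ℕ) : ℝ) * (1 / ((2 ^ (n + 2) : ℕ) : ℝ)) * (1 / 2) := by
          push_cast
          rw [← one_div_pow]
          ring
      _ ≤ _ := by gcongr
  calc (1 / 2 : ℝ) ^ (n ^ 2 + 5 * n + 5)
      = (1 / 2 : ℝ) ^ (n ^ 2 + 3 * n) * (1 / 2 : ℝ) ^ (2 * n + 5) := by
        rw [← pow_add]
        congr 1
        ring
    _ ≤ _ := by
        rw [← hprod]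
        exact (mul_le_mul_of_nonneg_left hdig (by positivity)).trans
          (h.prod_le_abs_sub h' n hab fun i _ => (ha i).2)

/-- A set containing every point whose `i`-th digit ranges freely over an interval
`[e i, e i + 2 ^ w i)`, `e i + 2 ^ w i ≤ 2 ^ (i + 2)`, has dimension at least `s` as soon as the
number of free bits grows at least like `s n²`. -/
theorem le_dimH_of_digits {e w : ℕ → ℕ} (he : ∀ i, 2 ≤ e i)
    (hew : ∀ i, e i + 2 ^ w i ≤ 2 ^ (i + 2)) {s : ℝ≥0} (hs : 0 < s) {C : ℝ}
    (hw : ∀ n : ℕ, s * ((n ^ 2 + 5 * n + 5 : ℕ) : ℝ) ≤ ((∑ i ∈ Finset.range n, w i : ℕ) : ℝ) + C)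
    {A : Set ℝ}
    (hA : ∀ (a : ℕ → ℕ) (u : ℕ → ℝ), IsCFOrbit a u → (∀ i, e i ≤ a i ∧ a i < e i + 2 ^ w i) →
      u 0 ∈ A) :
    (s : ℝ≥0∞) ≤ dimH A := by
  let dig : ℝ → ℕ → ℕ := fun y i => e i + bitBlock w y i
  have hdig : ∀ y i, 2 ≤ dig y i := fun y i => (he i).trans (Nat.le_add_right _ _)
  have hdig' : ∀ y ∈ Ico (0 : ℝ) 1, ∀ i, 2 ≤ dig y i ∧ dig y i < 2 ^ (i + 2) := fun y hy i =>
    ⟨hdig y i, (Nat.add_lt_add_left (bitBlock_lt w hy i) _).trans_le (hew i)⟩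
  choose u hu using fun y => exists_isCFOrbit (hdig y)
  have hpow : ∀ n : ℕ, (1 / 2 : ℝ) ^ ∑ i ∈ Finset.range n, w i
      ≤ 2 ^ C * ((1 / 2 : ℝ) ^ (n ^ 2 + 5 * n + 5)) ^ (s : ℝ) := by
    intro n
    have h2 : ∀ m : ℕ, (1 / 2 : ℝ) ^ m = (2 : ℝ) ^ (-(m : ℝ)) := fun m => by
      rw [Real.rpow_neg two_pos.le, Real.rpow_natCast, one_div, inv_pow]
    rw [h2, h2, ← Real.rpow_mul two_pos.le, ← Real.rpow_add two_pos]
    refine Real.rpow_le_rpow_of_exponent_le one_le_two ?_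
    linarith [hw n]
  have key : ∀ y ∈ Ico (0 : ℝ) 1, ∀ z ∈ Ico (0 : ℝ) 1,
      |y - z| ≤ 2 ^ C * |u y 0 - u z 0| ^ (s : ℝ) := by
    intro y hy z hz
    by_cases hall : ∀ i, bitBlock w y i = bitBlock w z i
    · have hyz : |y - z| ≤ 0 := by
        have hlim : Tendsto (fun n : ℕ => (2 : ℝ) ^ C * ((1 / 2 : ℝ) ^ n) ^ (s : ℝ)) atTop
            (𝓝 (2 ^ C * (0 : ℝ) ^ (s : ℝ))) :=
          ((tendsto_pow_atTop_nhds_zero_of_lt_one (by norm_num) (by norm_num)).rpow_const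
            (Or.inr s.coe_nonneg)).const_mul _
        rw [Real.zero_rpow (by exact_mod_cast hs.ne'), mul_zero] at hlim
        refine ge_of_tendsto' hlim fun n => ?_
        refine (abs_sub_le_of_bitBlock_eq w hy hz n fun i _ => hall i).trans
          ((hpow n).trans ?_)
        gcongr ?_ * ?_ ^ (_ : ℝ)
        exact pow_le_pow_of_le_one (by norm_num) (by norm_num) (by nlinarith)
      exact hyz.trans (by positivity)
    · push Not at hall
      classical
      let n := Nat.find hall
      have hn : bitBlock w y n ≠ bitBlock w z n := Nat.find_spec hall
      have hlt : ∀ i < n, bitBlock w y i = bitBlock w z i := fun i hi =>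
        not_not.1 (Nat.find_min hall hi)
      refine (abs_sub_le_of_bitBlock_eq w hy hz n hlt).trans ((hpow n).trans ?_)
      gcongr
      exact (hu y).pow_le_abs_sub (hu z) (hdig' y hy) (hdig' z hz) n
        (fun i hi => congrArg (e i + ·) (hlt i hi)) fun h => hn (Nat.add_left_cancel h)
  have hinj : InjOn (fun y => u y 0) (Ico (0 : ℝ) 1) := by
    intro y hy z hz hyz
    have := key y hy z hz
    simp only at hyz
    rw [hyz, sub_self, abs_zero, Real.zero_rpow (by exact_mod_cast hs.ne'), mul_zero] at this
    exact sub_eq_zero.1 (abs_nonpos_iff.1 this)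
  let g := Function.invFunOn (fun y => u y 0) (Ico (0 : ℝ) 1)
  have hg : ∀ y ∈ Ico (0 : ℝ) 1, g (u y 0) = y := fun y hy => hinj.leftInvOn_invFunOn hy
  have hhol : HolderOnWith ((2 : ℝ≥0) ^ C) s g ((fun y => u y 0) '' Ico (0 : ℝ) 1) := by
    rintro _ ⟨y, hy, rfl⟩ _ ⟨z, hz, rfl⟩
    simp only [hg y hy, hg z hz]
    rw [edist_dist, edist_dist, Real.dist_eq, Real.dist_eq,
      ENNReal.ofReal_rpow_of_nonneg (abs_nonneg _) s.coe_nonneg]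
    have hC : (((2 : ℝ≥0) ^ C : ℝ≥0) : ℝ≥0∞) = ENNReal.ofReal (2 ^ C) := by
      rw [ENNReal.ofReal, Real.toNNReal_rpow_of_nonneg two_pos.le]
      simp
    rw [hC, ← ENNReal.ofReal_mul (by positivity)]
    exact ENNReal.ofReal_le_ofReal (key y hy z hz)
  have hdim := hhol.dimH_image_le hs
  have himg : g '' ((fun y => u y 0) '' Ico (0 : ℝ) 1) = Ico (0 : ℝ) 1 := by
    rw [image_image]
    exact (image_congr hg).trans (image_id' _)
  have hone : dimH (Ico (0 : ℝ) 1) = 1 := by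
    rw [Real.dimH_of_nonempty_interior (by rw [interior_Ico]; exact nonempty_Ioo.2 one_pos)]
    simp
  rw [himg, hone, ENNReal.le_div_iff_mul_le (Or.inl (by exact_mod_cast hs.ne'))
    (Or.inl ENNReal.coe_ne_top), one_mul] at hdim
  refine hdim.trans (dimH_mono ?_)
  rintro _ ⟨y, hy, rfl⟩
  exact hA _ _ (hu y) fun i => ⟨Nat.le_add_right _ _, Nat.add_lt_add_left (bitBlock_lt w hy i) _⟩

/-- The position `p` lies in one of the windows `[σ n, σ n + n)`, `n ≥ 1`. -/
def InWindow (σ : ℕ → ℕ) (p : ℕ) : Prop := ∃ n, 1 ≤ n ∧ σ n ≤ p ∧ p < σ n + n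

open Classical in
/-- The least admissible digit at position `i + 1`: the powers of two, continued inside each window
as an arithmetic progression with difference `1`. -/
noncomputable def baseDigit (σ : ℕ → ℕ) (i : ℕ) : ℕ :=
  if h : InWindow σ (i + 1) then 2 ^ σ h.choose + (i + 1 - σ h.choose) else 2 ^ (i + 1)

open Classical in
/-- The number of free bits of the digit at position `i + 1`. -/
noncomputable def freeBits (σ : ℕ → ℕ) (i : ℕ) : ℕ := if InWindow σ (i + 1) then 0 else i + 1

section Windows

variable {σ : ℕ → ℕ}

theorem add_le_of_lt_of_gap (hmono : ∀ n : ℕ, 1 ≤ n → σ n < σ (n + 1))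
    (hgap : ∀ n : ℕ, 1 ≤ n → n ≤ σ (n + 1) - σ n) {n m : ℕ} (hn : 1 ≤ n) (hnm : n < m) :
    σ n + n ≤ σ m := by
  induction m, hnm using Nat.le_induction with
  | base =>
    have := hmono n hn
    have := hgap n hn
    simp only [Nat.succ_eq_add_one]
    omega
  | succ m hm ih => have := hmono m (by omega); omega

theorem baseDigit_of_mem (hmono : ∀ n : ℕ, 1 ≤ n → σ n < σ (n + 1))
    (hgap : ∀ n : ℕ, 1 ≤ n → n ≤ σ (n + 1) - σ n) {n i : ℕ} (hn : 1 ≤ n) (h1 : σ n ≤ i + 1)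
    (h2 : i + 1 < σ n + n) : baseDigit σ i = 2 ^ σ n + (i + 1 - σ n) ∧ freeBits σ i = 0 := by
  have h : InWindow σ (i + 1) := ⟨n, hn, h1, h2⟩
  obtain ⟨hm, h3, h4⟩ := h.choose_spec
  have : h.choose = n := by
    rcases lt_trichotomy h.choose n with hlt | heq | hlt
    · have := add_le_of_lt_of_gap hmono hgap hm hlt; omega
    · exact heq
    · have := add_le_of_lt_of_gap hmono hgap hn hlt; omega
  rw [baseDigit, dif_pos h, freeBits, if_pos h, this]
  exact ⟨rfl, rfl⟩

theorem baseDigit_of_not_inWindow {i : ℕ} (h : ¬InWindow σ (i + 1)) :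
    baseDigit σ i = 2 ^ (i + 1) ∧ freeBits σ i = i + 1 := by
  rw [baseDigit, dif_neg h, freeBits, if_neg h]
  exact ⟨rfl, rfl⟩

theorem self_le_of_strictMono (hσ1 : 1 ≤ σ 1) (hmono : ∀ n : ℕ, 1 ≤ n → σ n < σ (n + 1)) {n : ℕ}
    (hn : 1 ≤ n) : n ≤ σ n := by
  induction n, hn using Nat.le_induction with
  | base => exact hσ1
  | succ n hn ih => have := hmono n hn; omega

theorem two_le_baseDigit (hσ1 : 1 ≤ σ 1) (hmono : ∀ n : ℕ, 1 ≤ n → σ n < σ (n + 1))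
    (hgap : ∀ n : ℕ, 1 ≤ n → n ≤ σ (n + 1) - σ n) (i : ℕ) : 2 ≤ baseDigit σ i := by
  by_cases h : InWindow σ (i + 1)
  · obtain ⟨n, hn, h1, h2⟩ := h
    rw [(baseDigit_of_mem hmono hgap hn h1 h2).1]
    have h3 : 1 ≤ σ n := hn.trans (self_le_of_strictMono hσ1 hmono hn)
    exact (Nat.pow_le_pow_right two_pos h3).trans (Nat.le_add_right _ _)
  · rw [(baseDigit_of_not_inWindow h).1]
    exact Nat.pow_le_pow_right two_pos (Nat.le_add_left 1 i)

theorem baseDigit_add_le (hmono : ∀ n : ℕ, 1 ≤ n → σ n < σ (n + 1))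
    (hgap : ∀ n : ℕ, 1 ≤ n → n ≤ σ (n + 1) - σ n) (i : ℕ) :
    baseDigit σ i + 2 ^ freeBits σ i ≤ 2 ^ (i + 2) := by
  by_cases h : InWindow σ (i + 1)
  · obtain ⟨n, hn, h1, h2⟩ := h
    obtain ⟨h3, h4⟩ := baseDigit_of_mem hmono hgap hn h1 h2
    have h5 : 2 ^ σ n ≤ 2 ^ (i + 1) := Nat.pow_le_pow_right two_pos h1
    have h6 : i + 1 < 2 ^ (i + 1) := Nat.lt_two_pow_self
    rw [h3, h4, pow_zero, pow_succ 2 (i + 1)]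
    omega
  · obtain ⟨h3, h4⟩ := baseDigit_of_not_inWindow h
    rw [h3, h4, pow_succ 2 (i + 1)]
    omega

/-- Points whose digits are prescribed by `baseDigit` and `freeBits` belong to the `G`-set. -/
theorem mem_Gset_of_digits (hσ1 : 1 ≤ σ 1) (hmono : ∀ n : ℕ, 1 ≤ n → σ n < σ (n + 1))
    (hgap : ∀ n : ℕ, 1 ≤ n → n ≤ σ (n + 1) - σ n) {a : ℕ → ℕ} {u : ℕ → ℝ} (hu : IsCFOrbit a u)
    (ha : ∀ i, baseDigit σ i ≤ a i ∧ a i < baseDigit σ i + 2 ^ freeBits σ i) : u 0 ∈ Gset σ := by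
  have hwin : ∀ n i, 1 ≤ n → σ n ≤ i + 1 → i + 1 < σ n + n → a i = 2 ^ σ n + (i + 1 - σ n) := by
    intro n i hn h1 h2
    obtain ⟨h3, h4⟩ := baseDigit_of_mem hmono hgap hn h1 h2
    have := ha i
    rw [h4, pow_zero] at this
    omega
  have hlt : ∀ i, a i < a (i + 1) := by
    intro i
    have hi : a i < 2 ^ (i + 2) := (ha i).2.trans_le (baseDigit_add_le hmono hgap i)
    by_cases h : InWindow σ (i + 2)
    · obtain ⟨n, hn, h1, h2⟩ := h
      rw [hwin n (i + 1) hn h1 h2]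
      rcases h1.eq_or_lt with heq | hlt
      · rw [heq]
        exact hi.trans_le (Nat.le_add_right _ _)
      · rw [hwin n i hn (by omega) (by omega)]
        omega
    · refine hi.trans_le ?_
      rw [← (baseDigit_of_not_inWindow (i := i + 1) h).1]
      exact (ha (i + 1)).1
  refine ⟨⟨(hu 0).1, hu.irrational, fun n hn => ?_⟩, 1, fun n hn => ⟨1, fun i hi => ?_⟩⟩
  · obtain ⟨m, rfl⟩ : ∃ m, n = m + 1 := ⟨n - 1, by omega⟩
    rw [hu.pq_eq, hu.pq_eq]
    exact hlt m
  · have hpos := self_le_of_strictMono hσ1 hmono hn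
    obtain ⟨m, hm⟩ : ∃ m, σ n + i = m + 1 := ⟨σ n + i - 1, by omega⟩
    rw [hm, hu.pq_eq, hu.pq_eq, hwin n m hn (by omega) (by omega),
      hwin n (m + 1) hn (by omega) (by omega)]
    omega

theorem exists_sq_le (hmono : ∀ n : ℕ, 1 ≤ n → σ n < σ (n + 1))
    (hlim : Tendsto (fun n : ℕ => ((σ (n + 1) - σ n : ℕ) : ℝ) / (n : ℝ)) atTop atTop)
    {ε : ℝ} (hε : 0 < ε) : ∃ C : ℝ, 0 ≤ C ∧ ∀ n : ℕ, 1 ≤ n → (n : ℝ) ^ 2 ≤ ε * σ n + C := by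
  obtain ⟨N, hN⟩ := eventually_atTop.1 (hlim.eventually_ge_atTop (3 / ε))
  refine ⟨((N : ℝ) + 1) ^ 2, by positivity, fun n hn => ?_⟩
  rcases le_or_gt n (N + 1) with h | h
  · have : (n : ℝ) ≤ N + 1 := by exact_mod_cast h
    have : (n : ℝ) ^ 2 ≤ (N + 1) ^ 2 := by gcongr
    have : 0 ≤ ε * σ n := by positivity
    linarith
  · induction n, h.le using Nat.le_induction with
    | base => exact absurd h (lt_irrefl _)
    | succ n hNn ih =>
      have hn1 : 1 ≤ n := by omega
      have ih' : (n : ℝ) ^ 2 ≤ ε * σ n + ((N : ℝ) + 1) ^ 2 := by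
        rcases hNn.eq_or_lt with heq | hlt
        · rw [← heq]
          push_cast
          have : 0 ≤ ε * (σ (N + 1) : ℝ) := by positivity
          linarith
        · exact ih hn1 hlt
      have hq := hN n (by omega)
      have hn0 : (1 : ℝ) ≤ n := by exact_mod_cast hn1
      rw [div_le_div_iff₀ hε (by linarith), Nat.cast_sub (hmono n hn1).le] at hq
      push_cast
      nlinarith

open Classical in
theorem card_filter_inWindow_le {ε C : ℝ} (hε : 0 < ε) (hC : 0 ≤ C)
    (hsq : ∀ n : ℕ, 1 ≤ n → (n : ℝ) ^ 2 ≤ ε * σ n + C) (k : ℕ) :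
    (((Finset.range k).filter fun i => InWindow σ (i + 1)).card : ℝ) ≤ ε * k + C := by
  set M := ⌊√(ε * k + C)⌋₊
  have hpos : 0 ≤ ε * k + C := by positivity
  have hM : (M : ℝ) ^ 2 ≤ ε * k + C := by
    rw [← Real.sq_sqrt hpos]
    gcongr
    exact Nat.floor_le (Real.sqrt_nonneg _)
  refine le_trans ?_ hM
  have hsub : ((Finset.range k).filter fun i => InWindow σ (i + 1)) ⊆
      (Finset.Icc 1 M ×ˢ Finset.range M).image fun q => σ q.1 + q.2 - 1 := by
    intro i hi
    rw [Finset.mem_filter, Finset.mem_range] at hi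
    obtain ⟨hik, n, hn, h1, h2⟩ := hi
    have hnM : n ≤ M := by
      refine Nat.le_floor (Real.le_sqrt_of_sq_le ((hsq n hn).trans ?_))
      have : (σ n : ℝ) ≤ k := by exact_mod_cast h1.trans hik
      gcongr
    refine Finset.mem_image.2 ⟨(n, i + 1 - σ n), ?_, ?_⟩
    · rw [Finset.mem_product, Finset.mem_Icc, Finset.mem_range]
      dsimp only
      omega
    · dsimp only
      omega
  have hcard := (Finset.card_le_card hsub).trans Finset.card_image_le
  rw [Finset.card_product, Nat.card_Icc, Finset.card_range, Nat.add_sub_cancel, ← sq] at hcard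
  exact_mod_cast hcard

theorem sq_div_two_le_sum_freeBits {ε C : ℝ} (hε : 0 < ε) (hC : 0 ≤ C)
    (hsq : ∀ n : ℕ, 1 ≤ n → (n : ℝ) ^ 2 ≤ ε * σ n + C) (k : ℕ) :
    (k : ℝ) ^ 2 / 2 - k * (ε * k + C) ≤ ((∑ i ∈ Finset.range k, freeBits σ i : ℕ) : ℝ) := by
  classical
  have hcard := card_filter_inWindow_le hε hC hsq k
  have htri : (k : ℝ) ^ 2 / 2 ≤ ∑ i ∈ Finset.range k, ((i : ℝ) + 1) := by
    clear hcard
    induction k with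
    | zero => simp
    | succ k ih =>
      rw [Finset.sum_range_succ]
      push_cast
      nlinarith
  have hterm : ∀ i ∈ Finset.range k,
      (i : ℝ) + 1 ≤ freeBits σ i + if InWindow σ (i + 1) then (k : ℝ) else 0 := by
    intro i hi
    have hik : (i : ℝ) + 1 ≤ k := by exact_mod_cast Finset.mem_range.1 hi
    by_cases h : InWindow σ (i + 1)
    · rw [if_pos h]
      exact hik.trans (le_add_of_nonneg_left (Nat.cast_nonneg _))
    · rw [if_neg h, (baseDigit_of_not_inWindow h).2]
      simp
  have hsum := htri.trans (Finset.sum_le_sum hterm)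
  rw [Finset.sum_add_distrib, ← Finset.sum_filter, Finset.sum_const, nsmul_eq_mul] at hsum
  have : (k : ℝ) * ((Finset.range k).filter fun i => InWindow σ (i + 1)).card
      ≤ k * (ε * k + C) := by gcongr
  push_cast
  linarith

end Windows

theorem half_le_dimH_Gset {σ : ℕ → ℕ} (hσ1 : 1 ≤ σ 1)
    (hmono : ∀ n : ℕ, 1 ≤ n → σ n < σ (n + 1))
    (hgap : ∀ n : ℕ, 1 ≤ n → n ≤ σ (n + 1) - σ n)
    (hlim : Tendsto (fun n : ℕ => ((σ (n + 1) - σ n : ℕ) : ℝ) / (n : ℝ)) atTop atTop) :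
    1 / 2 ≤ dimH (Gset σ) := by
  have hhalf : (1 / 2 : ℝ≥0∞) = ((1 / 2 : ℝ≥0) : ℝ≥0∞) := by simp
  rw [hhalf]
  refine le_of_forall_lt_imp_le_of_dense fun d hd => ?_
  lift d to ℝ≥0 using (hd.trans ENNReal.coe_lt_top).ne
  rcases eq_or_lt_of_le (zero_le (a := d)) with rfl | hd0
  · simp
  have hd2 : (d : ℝ) < 1 / 2 := by
    have : d < 1 / 2 := by exact_mod_cast hd
    exact_mod_cast this
  obtain ⟨C, hC0, hC⟩ := exists_sq_le hmono hlim (ε := (1 / 2 - d) / 2) (by linarith)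
  have hε : 0 < (1 / 2 - (d : ℝ)) / 2 := by linarith
  refine le_dimH_of_digits (e := baseDigit σ) (w := freeBits σ)
    (two_le_baseDigit hσ1 hmono hgap) (baseDigit_add_le hmono hgap) hd0
    (C := (C + 5 * d) ^ 2 / (4 * ((1 / 2 - d) / 2)) + 5 * d) (fun k => ?_)
    fun a u hu ha => mem_Gset_of_digits hσ1 hmono hgap hu ha
  have h := sq_div_two_le_sum_freeBits hε hC0 hC k
  set ε := (1 / 2 - (d : ℝ)) / 2 with hεd
  have hquad : (C + 5 * d) * k ≤ ε * (k : ℝ) ^ 2 + (C + 5 * d) ^ 2 / (4 * ε) := by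
    rw [← sub_nonneg]
    have : ε * (k : ℝ) ^ 2 + (C + 5 * d) ^ 2 / (4 * ε) - (C + 5 * d) * k
        = (2 * ε * k - (C + 5 * d)) ^ 2 / (4 * ε) := by
      field_simp
      ring
    rw [this]
    positivity
  have hd' : (d : ℝ) = 1 / 2 - 2 * ε := by rw [hεd]; ring
  have hk : (d : ℝ) * (k : ℝ) ^ 2 = (k : ℝ) ^ 2 / 2 - 2 * (ε * (k : ℝ) ^ 2) := by rw [hd']; ring
  push_cast at h ⊢
  linarith

/-- Theorem 1.2 (case `β = ∞`): if `(σ_{n+1} - σ_n)/n → ∞` then the `G`-set has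
Hausdorff dimension `1/2`. -/
theorem stmt3 (σ : ℕ → ℕ) (hσ1 : 1 ≤ σ 1)
    (hmono : ∀ n : ℕ, 1 ≤ n → σ n < σ (n + 1))
    (hgap : ∀ n : ℕ, 1 ≤ n → n ≤ σ (n + 1) - σ n)
    (hlim : Filter.Tendsto (fun n : ℕ => ((σ (n + 1) - σ n : ℕ) : ℝ) / (n : ℝ))
      Filter.atTop Filter.atTop) :
    dimH (Gset σ) = 1 / 2 :=
  le_antisymm ((dimH_mono fun _ hx => hx.1).trans dimH_Jset_le)
    (half_le_dimH_Gset hσ1 hmono hgap hlim)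
end
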